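/- arXiv:1201.1771 — 10 statements merged into one kernel-verified Lean document; each statement's English description precedes it below -/
import Mathlib

section
/- There is an absolute constant C > 0 with the following property. Let T > 0 and let θ, ψ : ℝ² × [0,T] → ℝ be smooth functions, 2π-periodic in both space variables, with ∫_{[0,2π]²} θ(x,y,t) dx dy = 0 for all t, satisfying Δψ(·,t) = θ(·,t) and ∂_t θ = ∂_x θ · ∂_y ψ − ∂_y θ · ∂_x ψ on ℝ² × [0,T]. If ‖θ(·,0)‖_∞ ≤ 1, then for all t ∈ [0,T]: ‖∇θ(·,t)‖_∞ ≤ exp( C (1 + log⁺ ‖∇θ(·,0)‖_∞) e^{Ct} ). -/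
open Real MeasureTheory Set

/-- Spatial partial derivative in `x` of a function of `(x, y, t)`. -/
noncomputable def pX (f : ℝ → ℝ → ℝ → ℝ) (x y t : ℝ) : ℝ := deriv (fun x' => f x' y t) x

/-- Spatial partial derivative in `y` of a function of `(x, y, t)`. -/
noncomputable def pY (f : ℝ → ℝ → ℝ → ℝ) (x y t : ℝ) : ℝ := deriv (fun y' => f x y' t) y

/-- Second spatial partial derivative in `x`. -/
noncomputable def pXX (f : ℝ → ℝ → ℝ → ℝ) (x y t : ℝ) : ℝ := deriv (fun x' => pX f x' y t) x

/-- Second spatial partial derivative in `y`. -/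
noncomputable def pYY (f : ℝ → ℝ → ℝ → ℝ) (x y t : ℝ) : ℝ := deriv (fun y' => pY f x y' t) y

/-- Sup norm over `ℝ²` of a function of two variables. -/
noncomputable def supNorm (f : ℝ → ℝ → ℝ) : ℝ := ⨆ p : ℝ × ℝ, |f p.1 p.2|

/-- Sup norm over `ℝ²` of the (Euclidean) spatial gradient of `f(·,·,t)`. -/
noncomputable def gradSupNorm (f : ℝ → ℝ → ℝ → ℝ) (t : ℝ) : ℝ :=
  ⨆ p : ℝ × ℝ, Real.sqrt ((pX f p.1 p.2 t) ^ 2 + (pY f p.1 p.2 t) ^ 2)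

/-- `θ, ψ` form a smooth, `2π`-periodic (in both space variables) solution of the
2D Euler equation in vorticity form on the torus, on the time interval `[0, T]`:
`Δψ(·,t) = θ(·,t)`, `θ(·,t)` has zero average and
`∂ₜθ = ∂ₓθ ∂_yψ − ∂_yθ ∂ₓψ`. -/
def IsEulerOnTorus (T : ℝ) (θ ψ : ℝ → ℝ → ℝ → ℝ) : Prop :=
  ContDiffOn ℝ (⊤ : ℕ∞) (fun p : ℝ × ℝ × ℝ => θ p.1 p.2.1 p.2.2) {p : ℝ × ℝ × ℝ | p.2.2 ∈ Icc 0 T} ∧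
  ContDiffOn ℝ (⊤ : ℕ∞) (fun p : ℝ × ℝ × ℝ => ψ p.1 p.2.1 p.2.2) {p : ℝ × ℝ × ℝ | p.2.2 ∈ Icc 0 T} ∧
  (∀ x y t, θ (x + 2 * π) y t = θ x y t ∧ θ x (y + 2 * π) t = θ x y t) ∧
  (∀ x y t, ψ (x + 2 * π) y t = ψ x y t ∧ ψ x (y + 2 * π) t = ψ x y t) ∧
  (∀ t ∈ Icc 0 T, ∫ x in (0:ℝ)..(2 * π), ∫ y in (0:ℝ)..(2 * π), θ x y t = 0) ∧
  (∀ x y : ℝ, ∀ t ∈ Icc 0 T, pXX ψ x y t + pYY ψ x y t = θ x y t) ∧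
  (∀ x y : ℝ, ∀ t ∈ Icc 0 T,
    derivWithin (fun s => θ x y s) (Icc 0 T) t
      = pX θ x y t * pY ψ x y t - pY θ x y t * pX ψ x y t)



theorem aux_second_deriv {h h' : ℝ → ℝ} {c x0 : ℝ}
    (h1 : ∀ᶠ x in nhds x0, HasDerivAt h (h' x) x) (h2 : HasDerivAt h' c x0)
    (hm : IsLocalMax h x0) : c ≤ 0 := by
  by_contra hc
  push Not at hc
  have e1 : deriv h =ᶠ[nhds x0] h' := h1.mono fun x hx => hx.deriv
  have d1 : deriv h x0 = 0 := hm.deriv_eq_zero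
  have d2 : deriv (deriv h) x0 = c := by rw [e1.deriv_eq]; exact h2.deriv
  have hmin : IsLocalMin h x0 :=
    isLocalMin_of_deriv_deriv_pos (by rw [d2]; exact hc) d1 h1.self_of_nhds.continuousAt
  have hconst : h =ᶠ[nhds x0] fun _ => h x0 := by
    filter_upwards [hm, hmin] with x a b using le_antisymm a b
  have e2 : deriv h =ᶠ[nhds x0] deriv (fun _ => h x0) := hconst.deriv
  have : deriv (deriv h) x0 = 0 := by
    rw [e2.deriv_eq]; simp
  linarith

/-- barrier first derivative -/
theorem aux_w1 (M d y x : ℝ) (hs : 0 < x + y + d) :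
    HasDerivAt (fun x => 8 * (x * y * (M - log (x + y + d))))
      (8 * (y * (M - log (x + y + d)) - x * y / (x + y + d))) x := by
  have h0 : HasDerivAt (fun x : ℝ => x + y + d) 1 x := ((hasDerivAt_id x).add_const y).add_const d
  have hl := (h0.log hs.ne').const_sub M
  have hxy : HasDerivAt (fun x : ℝ => x * y) (1 * y) x := (hasDerivAt_id x).mul_const y
  refine ((hxy.mul hl).const_mul 8).congr_deriv ?_
  field_simp
  ring

theorem aux_w2 (M d y x : ℝ) (hs : 0 < x + y + d) :
    HasDerivAt (fun x => 8 * (y * (M - log (x + y + d)) - x * y / (x + y + d)))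
      (8 * (-2 * y / (x + y + d) + x * y / (x + y + d) ^ 2)) x := by
  have h0 : HasDerivAt (fun x : ℝ => x + y + d) 1 x := ((hasDerivAt_id x).add_const y).add_const d
  have hl := (h0.log hs.ne').const_sub M
  have hxy : HasDerivAt (fun x : ℝ => x * y) (1 * y) x := (hasDerivAt_id x).mul_const y
  refine (((hl.const_mul y).sub (hxy.div h0 hs.ne')).const_mul 8).congr_deriv ?_
  field_simp
  ring

theorem aux_ineq {x y G D : ℝ} (hx : 0 < x) (hy : 0 < y) (hG : 1 ≤ G)
    (b0 : -4 ≤ D) (b1 : -(4 * G * x) ≤ D) (b2 : -(4 * G * y) ≤ D)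
    (hD : D ≤ 8 * (-2 * y / (x + y + 1 / G) + x * y / (x + y + 1 / G) ^ 2) +
      8 * (-2 * x / (x + y + 1 / G) + x * y / (x + y + 1 / G) ^ 2)) : False := by
  have hG0 : 0 < G := by linarith
  have hs : 0 < x + y + 1 / G := by positivity
  have e : 8 * (-2 * y / (x + y + 1 / G) + x * y / (x + y + 1 / G) ^ 2) +
      8 * (-2 * x / (x + y + 1 / G) + x * y / (x + y + 1 / G) ^ 2) ≤
      -12 * ((x + y) / (x + y + 1 / G)) := by
    have : 0 ≤ 1 / G := by positivity
    rw [← sub_nonneg]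
    have : -12 * ((x + y) / (x + y + 1 / G)) - (8 * (-2 * y / (x + y + 1 / G) + x * y / (x + y + 1 / G) ^ 2) +
      8 * (-2 * x / (x + y + 1 / G) + x * y / (x + y + 1 / G) ^ 2)) =
      (4 * (x - y) ^ 2 + 4 * (x + y) * (1 / G)) / (x + y + 1 / G) ^ 2 := by
      field_simp
      ring
    rw [this]
    positivity
  have e2 : (x + y) / (x + y + 1 / G) = G * (x + y) / (G * (x + y) + 1) := by
    field_simp
  rw [e2] at e
  set τ := G * (x + y) with hτ
  have hτ0 : 0 < τ := by positivity
  have b3 : -(2 * τ) ≤ D := by rw [hτ]; linarith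
  have h1 : D * (τ + 1) ≤ -12 * τ := by
    have h2 := hD.trans e
    have h3 : -12 * (τ / (τ + 1)) * (τ + 1) = -12 * τ := by field_simp
    rw [← h3]
    exact mul_le_mul_of_nonneg_right h2 (by positivity)
  rcases le_or_gt 2 τ with h | h <;> nlinarith

/-- Upper bound for the antisymmetrisation -/
theorem aux_antisym {P Px Py Pxx Pyy : ℝ → ℝ → ℝ} {G : ℝ} (hG : 1 ≤ G)
    (hc : Continuous (fun p : ℝ × ℝ => P p.1 p.2))
    (hx : ∀ x y, HasDerivAt (fun x => P x y) (Px x y) x)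
    (hxx : ∀ x y, HasDerivAt (fun x => Px x y) (Pxx x y) x)
    (hy : ∀ x y, HasDerivAt (fun y => P x y) (Py x y) y)
    (hyy : ∀ x y, HasDerivAt (fun y => Py x y) (Pyy x y) y)
    (z1 : ∀ y, P 0 y = 0) (z2 : ∀ y, P π y = 0) (z3 : ∀ x, P x 0 = 0) (z4 : ∀ x, P x π = 0)
    (b0 : ∀ x y, -4 ≤ Pxx x y + Pyy x y)
    (b1 : ∀ x y, 0 < x → 0 < y → -(4 * G * x) ≤ Pxx x y + Pyy x y)
    (b2 : ∀ x y, 0 < x → 0 < y → -(4 * G * y) ≤ Pxx x y + Pyy x y) :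
    ∀ x ∈ Icc (0:ℝ) π, ∀ y ∈ Icc (0:ℝ) π,
      P x y ≤ 8 * (x * y * (log (2 * π + 1) - log (x + y + 1 / G))) := by
  have hG0 : 0 < G := by linarith
  have hd : 0 < 1 / G := by positivity
  have hd1 : 1 / G ≤ 1 := by rw [div_le_one hG0]; exact hG
  set d := 1 / G with hdd
  set M := log (2 * π + 1) with hM
  have hpi := Real.pi_pos
  have hcont : ContinuousOn (fun p : ℝ × ℝ => P p.1 p.2 - 8 * (p.1 * p.2 * (M - log (p.1 + p.2 + d))))
      (Icc (0:ℝ) π ×ˢ Icc (0:ℝ) π) := by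
    refine hc.continuousOn.sub (ContinuousOn.mul continuousOn_const (ContinuousOn.mul (by fun_prop) ?_))
    refine continuousOn_const.sub (ContinuousOn.log (by fun_prop) ?_)
    rintro ⟨x, y⟩ ⟨⟨h1, h2⟩, h3, h4⟩
    have : 0 < x + y + d := by simp only at *; linarith
    exact this.ne'
  obtain ⟨⟨x0, y0⟩, ⟨⟨p1, p2⟩, p3, p4⟩, hmax⟩ :=
    (isCompact_Icc.prod isCompact_Icc).exists_isMaxOn
      (s := Icc (0:ℝ) π ×ˢ Icc (0:ℝ) π) ⟨(0, 0), by simp [hpi.le]⟩ hcont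
  simp only at p1 p2 p3 p4
  have hmax' : ∀ x ∈ Icc (0:ℝ) π, ∀ y ∈ Icc (0:ℝ) π,
      P x y - 8 * (x * y * (M - log (x + y + d))) ≤ P x0 y0 - 8 * (x0 * y0 * (M - log (x0 + y0 + d))) :=
    fun x hx y hy => hmax (show (x, y) ∈ Icc (0:ℝ) π ×ˢ Icc (0:ℝ) π from ⟨hx, hy⟩)
  suffices hs : P x0 y0 - 8 * (x0 * y0 * (M - log (x0 + y0 + d))) ≤ 0 by
    intro x hx y hy
    linarith [hmax' x hx y hy]
  have hlog : 0 ≤ M - log (x0 + y0 + d) := by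
    rw [sub_nonneg]
    exact Real.log_le_log (by linarith) (by linarith)
  have hw : 0 ≤ 8 * (x0 * y0 * (M - log (x0 + y0 + d))) := by positivity
  rcases p1.eq_or_lt with h | h1
  · have : P x0 y0 = 0 := by rw [← h, z1]
    linarith
  rcases p2.eq_or_lt with h | h2
  · have : P x0 y0 = 0 := by rw [h, z2]
    linarith
  rcases p3.eq_or_lt with h | h3
  · have : P x0 y0 = 0 := by rw [← h, z3]
    linarith
  rcases p4.eq_or_lt with h | h4
  · have : P x0 y0 = 0 := by rw [h, z4]
    linarith
  exfalso
  have A1 : Pxx x0 y0 - 8 * (-2 * y0 / (x0 + y0 + d) + x0 * y0 / (x0 + y0 + d) ^ 2) ≤ 0 := by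
    refine aux_second_deriv (h := fun x => P x y0 - 8 * (x * y0 * (M - log (x + y0 + d))))
      (x0 := x0) (h' := fun x => Px x y0 - 8 * (y0 * (M - log (x + y0 + d)) - x * y0 / (x + y0 + d)))
      ?_ ((hxx x0 y0).sub (aux_w2 M d y0 x0 (by linarith))) ?_
    · filter_upwards [lt_mem_nhds h1] with x hx'
      exact (hx x y0).sub (aux_w1 M d y0 x (by linarith))
    · filter_upwards [Icc_mem_nhds h1 h2] with x hx'
      exact hmax' x hx' y0 ⟨p3, p4⟩
  have A2 : Pyy x0 y0 - 8 * (-2 * x0 / (y0 + x0 + d) + y0 * x0 / (y0 + x0 + d) ^ 2) ≤ 0 := by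
    refine aux_second_deriv (h := fun y => P x0 y - 8 * (y * x0 * (M - log (y + x0 + d))))
      (x0 := y0) (h' := fun y => Py x0 y - 8 * (x0 * (M - log (y + x0 + d)) - y * x0 / (y + x0 + d)))
      ?_ ((hyy x0 y0).sub (aux_w2 M d x0 y0 (by linarith))) ?_
    · filter_upwards [lt_mem_nhds h3] with y hy'
      exact (hy x0 y).sub (aux_w1 M d x0 y (by linarith))
    · filter_upwards [Icc_mem_nhds h3 h4] with y hy'
      have := hmax' x0 ⟨p1, p2⟩ y hy'
      simpa only [mul_comm, add_comm] using this
  rw [add_comm y0 x0, mul_comm y0 x0] at A2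
  exact aux_ineq h1 h3 hG (b0 x0 y0) (b1 x0 y0 h1 h3) (b2 x0 y0 h1 h3) (by linarith)

/-- one-sided slope comparison -/
theorem aux_slope {h : ℝ → ℝ} {c m r : ℝ} (hr : 0 < r) (h0 : h 0 = 0) (hd : HasDerivAt h c 0)
    (hb : ∀ x, 0 < x → x < r → h x ≤ m * x) : c ≤ m := by
  have h1 := hd.hasDerivWithinAt (s := Ioi 0)
  rw [hasDerivWithinAt_iff_tendsto_slope' (by simp)] at h1
  refine le_of_tendsto h1 ?_
  filter_upwards [Ioo_mem_nhdsGT hr] with x hx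
  rw [slope_def_field, h0, sub_zero, sub_zero, div_le_iff₀ hx.1]
  exact hb x hx.1 hx.2

theorem aux_elliptic_one {F Fx Fy Fxx Fyy Fxy : ℝ → ℝ → ℝ} {G : ℝ} (hG : 1 ≤ G)
    (hc : Continuous (fun p : ℝ × ℝ => F p.1 p.2))
    (hx : ∀ x y, HasDerivAt (fun x => F x y) (Fx x y) x)
    (hxx : ∀ x y, HasDerivAt (fun x => Fx x y) (Fxx x y) x)
    (hy : ∀ x y, HasDerivAt (fun y => F x y) (Fy x y) y)
    (hyy : ∀ x y, HasDerivAt (fun y => Fy x y) (Fyy x y) y)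
    (hxy : ∀ x y, HasDerivAt (fun y => Fx x y) (Fxy x y) y)
    (px : ∀ x y, F (x + 2 * π) y = F x y) (py : ∀ x y, F x (y + 2 * π) = F x y)
    (b : ∀ x y, |Fxx x y + Fyy x y| ≤ 1)
    (lx : ∀ x x' y, |(Fxx x y + Fyy x y) - (Fxx x' y + Fyy x' y)| ≤ G * |x - x'|)
    (ly : ∀ x y y', |(Fxx x y + Fyy x y) - (Fxx x y' + Fyy x y')| ≤ G * |y - y'|)
    (a c : ℝ) : Fxy a c ≤ 2 * log ((2 * π + 1) * G) := by
  have hG0 : 0 < G := by linarith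
  have hpi := Real.pi_pos
  have cp : ∀ (u : ℝ → ℝ) (u' k x : ℝ), HasDerivAt u u' (k + x) → HasDerivAt (fun x => u (k + x)) u' x :=
    fun u u' k x h => h.comp_const_add k x
  have cm : ∀ (u : ℝ → ℝ) (u' k x : ℝ), HasDerivAt u u' (k - x) → HasDerivAt (fun x => u (k - x)) (-u') x :=
    fun u u' k x h => h.comp_const_sub k x
  have key := aux_antisym (G := G)
    (P := fun x y => F (a + x) (c + y) - F (a - x) (c + y) - F (a + x) (c - y) + F (a - x) (c - y))
    (Px := fun x y => Fx (a + x) (c + y) - (-Fx (a - x) (c + y)) - Fx (a + x) (c - y) + (-Fx (a - x) (c - y)))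
    (Pxx := fun x y => Fxx (a + x) (c + y) - (-(-Fxx (a - x) (c + y))) - Fxx (a + x) (c - y) + (-(-Fxx (a - x) (c - y))))
    (Py := fun x y => Fy (a + x) (c + y) - (Fy (a - x) (c + y)) - (-Fy (a + x) (c - y)) + (-Fy (a - x) (c - y)))
    (Pyy := fun x y => Fyy (a + x) (c + y) - (Fyy (a - x) (c + y)) - (-(-Fyy (a + x) (c - y))) + (-(-Fyy (a - x) (c - y))))
    hG ?_ ?_ ?_ ?_ ?_ ?_ ?_ ?_ ?_ ?_ ?_ ?_
  · set m := 8 * log ((2 * π + 1) * G) with hm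
    have bd : ∀ x y, 0 < x → x < π → 0 < y → y < π →
        F (a + x) (c + y) - F (a - x) (c + y) - F (a + x) (c - y) + F (a - x) (c - y) ≤ (m * y) * x := by
      intro x y h1 h2 h3 h4
      refine (key x ⟨h1.le, h2.le⟩ y ⟨h3.le, h4.le⟩).trans ?_
      have : log (2 * π + 1) - log (x + y + 1 / G) ≤ log ((2 * π + 1) * G) := by
        rw [Real.log_mul (by positivity) (by positivity)]
        have : log (1 / G) ≤ log (x + y + 1 / G) := Real.log_le_log (by positivity) (by linarith)
        rw [one_div, Real.log_inv] at this
        rw [one_div]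
        linarith
      have hxy : 0 < x * y := by positivity
      rw [hm]
      nlinarith [mul_le_mul_of_nonneg_left this hxy.le]
    have bd2 : ∀ y, 0 < y → y < π →
        Fx a (c + y) - (-Fx a (c + y)) - Fx a (c - y) + (-Fx a (c - y)) ≤ m * y := by
      intro y h1 h2
      refine aux_slope (h := fun x => F (a + x) (c + y) - F (a - x) (c + y) - F (a + x) (c - y) + F (a - x) (c - y))
        hpi (by simp) ?_ (fun x h3 h4 => bd x y h3 h4 h1 h2)
      refine (((cp (fun x => F x (c + y)) _ a 0 ?_).sub (cm (fun x => F x (c + y)) _ a 0 ?_)).sub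
        (cp (fun x => F x (c - y)) _ a 0 ?_)).add (cm (fun x => F x (c - y)) _ a 0 ?_) <;>
      simpa using hx a _
    have := aux_slope (h := fun y => Fx a (c + y) - (-Fx a (c + y)) - Fx a (c - y) + (-Fx a (c - y)))
      (c := Fxy a c - (- Fxy a c) - (-Fxy a c) + (-(-Fxy a c)))
      hpi (by simp) ?_ bd2
    · rw [hm] at this; linarith
    · have q1 := cp (fun y => Fx a y) (Fxy a c) c 0 (by simpa using hxy a c)
      have q2 := cm (fun y => Fx a y) (Fxy a c) c 0 (by simpa using hxy a c)
      exact ((q1.sub q1.neg).sub q2).add q2.neg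
  · have : ∀ u v : ℝ × ℝ → ℝ, Continuous u → Continuous v → Continuous fun p => F (u p) (v p) :=
      fun u v hu hv => hc.comp (hu.prodMk hv)
    refine (((this _ _ ?_ ?_).sub (this _ _ ?_ ?_)).sub (this _ _ ?_ ?_)).add (this _ _ ?_ ?_) <;> fun_prop
  · intro x y
    exact (((cp _ _ a x (hx _ _)).sub (cm _ _ a x (hx _ _))).sub (cp _ _ a x (hx _ _))).add (cm _ _ a x (hx _ _))
  · intro x y
    exact (((cp _ _ a x (hxx _ _)).sub (cm _ _ a x (hxx _ _)).neg).sub (cp _ _ a x (hxx _ _))).add (cm _ _ a x (hxx _ _)).neg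
  · intro x y
    exact (((cp _ _ c y (hy _ _)).sub (cp _ _ c y (hy _ _))).sub (cm _ _ c y (hy _ _))).add (cm _ _ c y (hy _ _))
  · intro x y
    exact (((cp _ _ c y (hyy _ _)).sub (cp _ _ c y (hyy _ _))).sub (cm _ _ c y (hyy _ _)).neg).add (cm _ _ c y (hyy _ _)).neg
  · intro y; simp
  · intro y
    have : a + π = (a - π) + 2 * π := by ring
    simp only [this, px]; ring
  · intro x; simp
  · intro x
    have : c + π = (c - π) + 2 * π := by ring
    simp only [this, py]; ring
  · intro x y
    have h1 := abs_le.1 (b (a + x) (c + y))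
    have h2 := abs_le.1 (b (a - x) (c + y))
    have h3 := abs_le.1 (b (a + x) (c - y))
    have h4 := abs_le.1 (b (a - x) (c - y))
    linarith
  · intro x y h1 h2
    have h3 := abs_le.1 (lx (a + x) (a - x) (c + y))
    have h4 := abs_le.1 (lx (a + x) (a - x) (c - y))
    have : |a + x - (a - x)| = 2 * x := by rw [show a + x - (a - x) = 2 * x by ring, abs_of_pos (by linarith)]
    rw [this] at h3 h4
    linarith
  · intro x y h1 h2
    have h3 := abs_le.1 (ly (a + x) (c + y) (c - y))
    have h4 := abs_le.1 (ly (a - x) (c + y) (c - y))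
    have : |c + y - (c - y)| = 2 * y := by rw [show c + y - (c - y) = 2 * y by ring, abs_of_pos (by linarith)]
    rw [this] at h3 h4
    linarith

theorem aux_elliptic {F Fx Fy Fxx Fyy Fxy : ℝ → ℝ → ℝ} {G : ℝ} (hG : 1 ≤ G)
    (hc : Continuous (fun p : ℝ × ℝ => F p.1 p.2))
    (hx : ∀ x y, HasDerivAt (fun x => F x y) (Fx x y) x)
    (hxx : ∀ x y, HasDerivAt (fun x => Fx x y) (Fxx x y) x)
    (hy : ∀ x y, HasDerivAt (fun y => F x y) (Fy x y) y)
    (hyy : ∀ x y, HasDerivAt (fun y => Fy x y) (Fyy x y) y)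
    (hxy : ∀ x y, HasDerivAt (fun y => Fx x y) (Fxy x y) y)
    (px : ∀ x y, F (x + 2 * π) y = F x y) (py : ∀ x y, F x (y + 2 * π) = F x y)
    (b : ∀ x y, |Fxx x y + Fyy x y| ≤ 1)
    (lx : ∀ x x' y, |(Fxx x y + Fyy x y) - (Fxx x' y + Fyy x' y)| ≤ G * |x - x'|)
    (ly : ∀ x y y', |(Fxx x y + Fyy x y) - (Fxx x y' + Fyy x y')| ≤ G * |y - y'|)
    (a c : ℝ) : |Fxy a c| ≤ 2 * log ((2 * π + 1) * G) := by
  rw [abs_le]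
  refine ⟨?_, aux_elliptic_one hG hc hx hxx hy hyy hxy px py b lx ly a c⟩
  have hn : ∀ u v : ℝ, |-u + -v| = |u + v| := fun u v => by rw [← abs_neg]; congr 1; ring
  have hn2 : ∀ u v u' v' : ℝ, |(-u + -v) - (-u' + -v')| = |(u + v) - (u' + v')| :=
    fun u v u' v' => by rw [← abs_neg]; congr 1; ring
  have := aux_elliptic_one (F := fun x y => -F x y) (Fx := fun x y => -Fx x y)
    (Fy := fun x y => -Fy x y) (Fxx := fun x y => -Fxx x y) (Fyy := fun x y => -Fyy x y)
    (Fxy := fun x y => -Fxy x y) hG hc.neg (fun x y => (hx x y).neg) (fun x y => (hxx x y).neg)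
    (fun x y => (hy x y).neg) (fun x y => (hyy x y).neg) (fun x y => (hxy x y).neg)
    (fun x y => by rw [px]) (fun x y => by rw [py]) (fun x y => by rw [hn]; exact b x y)
    (fun x x' y => by rw [hn2]; exact lx x x' y) (fun x y y' => by rw [hn2]; exact ly x y y') a c
  linarith

theorem aux_exists_max {H : ℝ → ℝ → ℝ → ℝ} {T : ℝ} (hT : 0 ≤ T)
    (hc : ContinuousOn (fun p : ℝ × ℝ × ℝ => H p.1 p.2.1 p.2.2) {p | p.2.2 ∈ Icc 0 T})
    (px : ∀ x y, ∀ t ∈ Icc 0 T, H (x + 2 * π) y t = H x y t)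
    (py : ∀ x y, ∀ t ∈ Icc 0 T, H x (y + 2 * π) t = H x y t) :
    ∃ x0 y0, ∃ t0 ∈ Icc 0 T, ∀ x y, ∀ t ∈ Icc 0 T, H x y t ≤ H x0 y0 t0 := by
  have hpi : (0:ℝ) < 2 * π := by positivity
  obtain ⟨⟨x0, y0, t0⟩, ⟨-, -, h0⟩, hmax⟩ :=
    (isCompact_Icc.prod (isCompact_Icc.prod isCompact_Icc)).exists_isMaxOn
      (s := Icc (0:ℝ) (2 * π) ×ˢ Icc (0:ℝ) (2 * π) ×ˢ Icc (0:ℝ) T) ⟨(0, 0, 0), by simp [hpi.le, hT]⟩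
      (hc.mono fun p hp => hp.2.2)
  refine ⟨x0, y0, t0, h0, fun x y t ht => ?_⟩
  obtain ⟨x', hx', ex⟩ := Function.Periodic.exists_mem_Ico₀ (f := fun x => H x y t) (fun x => px x y t ht) hpi x
  obtain ⟨y', hy', ey⟩ := Function.Periodic.exists_mem_Ico₀ (f := fun y => H x' y t) (fun y => py x' y t ht) hpi y
  refine (ex.trans ey).le.trans ?_
  exact hmax (show (x', y', t) ∈ _ from ⟨Ico_subset_Icc_self hx', Ico_subset_Icc_self hy', ht⟩)

theorem aux_parabolic {H : ℝ → ℝ → ℝ → ℝ} {T : ℝ} (hT : 0 ≤ T)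
    (hc : ContinuousOn (fun p : ℝ × ℝ × ℝ => H p.1 p.2.1 p.2.2) {p | p.2.2 ∈ Icc 0 T})
    (px : ∀ x y, ∀ t ∈ Icc 0 T, H (x + 2 * π) y t = H x y t)
    (py : ∀ x y, ∀ t ∈ Icc 0 T, H x (y + 2 * π) t = H x y t)
    (hd : ∀ x0 y0 t0, t0 ∈ Ioc 0 T → (∀ x y, H x y t0 ≤ H x0 y0 t0) →
      ∃ d < 0, HasDerivAt (fun s => H x0 y0 s) d t0) :
    ∃ x0 y0, ∀ x y, ∀ t ∈ Icc 0 T, H x y t ≤ H x0 y0 0 := by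
  obtain ⟨x0, y0, t0, ht0, hm⟩ := aux_exists_max hT hc px py
  refine ⟨x0, y0, ?_⟩
  rcases ht0.1.eq_or_lt with h | h
  · intro x y t ht
    have := hm x y t ht
    rwa [← h] at this
  exfalso
  obtain ⟨d, hd0, hd⟩ := hd x0 y0 t0 ⟨h, ht0.2⟩ (fun x y => hm x y t0 ht0)
  have h1 := hd.hasDerivWithinAt (s := Iio t0)
  rw [hasDerivWithinAt_iff_tendsto_slope' (by simp)] at h1
  have : 0 ≤ d := by
    refine ge_of_tendsto h1 ?_
    filter_upwards [Ioo_mem_nhdsLT h] with s hs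
    rw [slope_def_field]
    have := hm x0 y0 s ⟨hs.1.le, hs.2.le.trans ht0.2⟩
    exact div_nonneg_of_nonpos (by linarith) (by linarith [hs.2])
  linarith

theorem aux_two : (2 : WithTop ℕ∞) ≤ ((⊤ : ℕ∞) : WithTop ℕ∞) :=
  WithTop.coe_le_coe.2 (le_top : (2 : ℕ∞) ≤ ⊤)

theorem aux_line {Ω : Set (ℝ × ℝ × ℝ)} (hΩ : IsOpen Ω) {f : ℝ × ℝ × ℝ → ℝ}
    (hf : ContDiffOn ℝ (⊤ : ℕ∞) f Ω) {γ : ℝ → ℝ × ℝ × ℝ} {v : ℝ × ℝ × ℝ} {s : ℝ}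
    (hγ : HasDerivAt γ v s) (hm : γ s ∈ Ω) :
    HasDerivAt (fun s => f (γ s)) (fderiv ℝ f (γ s) v) s := by
  have h1 : DifferentiableAt ℝ f (γ s) :=
    (hf.contDiffAt (hΩ.mem_nhds hm)).differentiableAt (by simp)
  exact h1.hasFDerivAt.comp_hasDerivAt s hγ

theorem aux_line2 {Ω : Set (ℝ × ℝ × ℝ)} (hΩ : IsOpen Ω) {f : ℝ × ℝ × ℝ → ℝ}
    (hf : ContDiffOn ℝ (⊤ : ℕ∞) f Ω) {γ : ℝ → ℝ × ℝ × ℝ} {w : ℝ × ℝ × ℝ} {s : ℝ}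
    (hγ : HasDerivAt γ w s) (hm : γ s ∈ Ω) (v : ℝ × ℝ × ℝ) :
    HasDerivAt (fun s => fderiv ℝ f (γ s) v) (fderiv ℝ (fderiv ℝ f) (γ s) w v) s := by
  have h0 : ContDiffAt ℝ 1 (fderiv ℝ f) (γ s) :=
    ((hf.contDiffAt (hΩ.mem_nhds hm)).of_le (m := 2) aux_two).fderiv_right (by norm_num)
  have h1 : DifferentiableAt ℝ (fderiv ℝ f) (γ s) := h0.differentiableAt (by simp)
  have h2 := h1.hasFDerivAt.comp_hasDerivAt s hγ
  exact (h2.clm_apply (hasDerivAt_const s v)).congr_deriv (by simp)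

theorem aux_symm {Ω : Set (ℝ × ℝ × ℝ)} (hΩ : IsOpen Ω) {f : ℝ × ℝ × ℝ → ℝ}
    (hf : ContDiffOn ℝ (⊤ : ℕ∞) f Ω) {q : ℝ × ℝ × ℝ} (hm : q ∈ Ω) (v w : ℝ × ℝ × ℝ) :
    fderiv ℝ (fderiv ℝ f) q v w = fderiv ℝ (fderiv ℝ f) q w v := by
  have h0 := hf.contDiffAt (hΩ.mem_nhds hm)
  exact ((h0.of_le (m := 2) aux_two).isSymmSndFDerivAt (by simp)) v w

theorem aux_lip {h h' : ℝ → ℝ} {G : ℝ} (hd : ∀ x, HasDerivAt h (h' x) x) (hb : ∀ x, |h' x| ≤ G)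
    (a b : ℝ) : |h a - h b| ≤ G * |a - b| :=
  convex_univ.norm_image_sub_le_of_norm_hasDerivWithin_le (f := h) (f' := h')
    (fun x _ => (hd x).hasDerivWithinAt) (fun x _ => hb x) (mem_univ b) (mem_univ a)

theorem aux_hess {T t G : ℝ} {th ps : ℝ × ℝ × ℝ → ℝ} (hG : 1 ≤ G) (ht : t ∈ Ioo 0 T)
    (hth : ContDiffOn ℝ (⊤ : ℕ∞) th {p : ℝ × ℝ × ℝ | p.2.2 ∈ Ioo 0 T})
    (hps : ContDiffOn ℝ (⊤ : ℕ∞) ps {p : ℝ × ℝ × ℝ | p.2.2 ∈ Ioo 0 T})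
    (px : ∀ x y, ps (x + 2 * π, y, t) = ps (x, y, t))
    (py : ∀ x y, ps (x, y + 2 * π, t) = ps (x, y, t))
    (hL : ∀ x y, fderiv ℝ (fderiv ℝ ps) (x, y, t) (1, 0, 0) (1, 0, 0) +
      fderiv ℝ (fderiv ℝ ps) (x, y, t) (0, 1, 0) (0, 1, 0) = th (x, y, t))
    (hb : ∀ x y, |th (x, y, t)| ≤ 1)
    (hx : ∀ x y, |fderiv ℝ th (x, y, t) (1, 0, 0)| ≤ G)
    (hy : ∀ x y, |fderiv ℝ th (x, y, t) (0, 1, 0)| ≤ G) (x y : ℝ) :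
    |fderiv ℝ (fderiv ℝ ps) (x, y, t) (0, 1, 0) (1, 0, 0)| ≤ 2 * log ((2 * π + 1) * G) ∧
    |fderiv ℝ (fderiv ℝ ps) (x, y, t) (0, 1, 0) (0, 1, 0) -
      fderiv ℝ (fderiv ℝ ps) (x, y, t) (1, 0, 0) (1, 0, 0)| ≤ 4 * log ((2 * π + 1) * (2 * G)) := by
  have hΩ : IsOpen {p : ℝ × ℝ × ℝ | p.2.2 ∈ Ioo 0 T} :=
    isOpen_Ioo.preimage (continuous_snd.comp continuous_snd)
  have mem : ∀ x y, ((x, y, t) : ℝ × ℝ × ℝ) ∈ {p : ℝ × ℝ × ℝ | p.2.2 ∈ Ioo 0 T} := fun _ _ => ht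
  have g1 : ∀ x y : ℝ, HasDerivAt (fun x => ((x, y, t) : ℝ × ℝ × ℝ)) (1, 0, 0) x := fun x y =>
    (hasDerivAt_id x).prodMk ((hasDerivAt_const x y).prodMk (hasDerivAt_const x t))
  have g2 : ∀ x y : ℝ, HasDerivAt (fun y => ((x, y, t) : ℝ × ℝ × ℝ)) (0, 1, 0) y := fun x y =>
    (hasDerivAt_const y x).prodMk ((hasDerivAt_id y).prodMk (hasDerivAt_const y t))
  have g3 : ∀ x y : ℝ, HasDerivAt (fun x => ((x - y, x + y, t) : ℝ × ℝ × ℝ)) (1, 1, 0) x := fun x y =>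
    ((hasDerivAt_id x).sub_const y).prodMk (((hasDerivAt_id x).add_const y).prodMk (hasDerivAt_const x t))
  have g4 : ∀ x y : ℝ, HasDerivAt (fun y => ((x - y, x + y, t) : ℝ × ℝ × ℝ)) (-1, 1, 0) y := fun x y =>
    ((hasDerivAt_id y).const_sub x).prodMk (((hasDerivAt_id y).const_add x).prodMk (hasDerivAt_const y t))
  have lx : ∀ x x' y, |th (x, y, t) - th (x', y, t)| ≤ G * |x - x'| := fun x x' y =>
    aux_lip (fun x => aux_line hΩ hth (g1 x y) (mem x y)) (fun x => hx x y) x x'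
  have ly : ∀ x y y', |th (x, y, t) - th (x, y', t)| ≤ G * |y - y'| := fun x y y' =>
    aux_lip (fun y => aux_line hΩ hth (g2 x y) (mem x y)) (fun y => hy x y) y y'
  have hcont : ∀ u v : ℝ × ℝ → ℝ, Continuous u → Continuous v → Continuous fun p => ps (u p, v p, t) := by
    intro u v hu hv
    exact hps.continuousOn.comp_continuous (hu.prodMk (hv.prodMk continuous_const)) (fun p => mem _ _)
  constructor
  · exact aux_elliptic (F := fun x y => ps (x, y, t)) (Fx := fun x y => fderiv ℝ ps (x, y, t) (1, 0, 0))
      (Fy := fun x y => fderiv ℝ ps (x, y, t) (0, 1, 0))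
      (Fxx := fun x y => fderiv ℝ (fderiv ℝ ps) (x, y, t) (1, 0, 0) (1, 0, 0))
      (Fyy := fun x y => fderiv ℝ (fderiv ℝ ps) (x, y, t) (0, 1, 0) (0, 1, 0))
      (Fxy := fun x y => fderiv ℝ (fderiv ℝ ps) (x, y, t) (0, 1, 0) (1, 0, 0))
      hG (hcont _ _ continuous_fst continuous_snd)
      (fun x y => aux_line hΩ hps (g1 x y) (mem x y))
      (fun x y => aux_line2 hΩ hps (g1 x y) (mem x y) _)
      (fun x y => aux_line hΩ hps (g2 x y) (mem x y))
      (fun x y => aux_line2 hΩ hps (g2 x y) (mem x y) _)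
      (fun x y => aux_line2 hΩ hps (g2 x y) (mem x y) _) px py
      (fun x y => by rw [hL]; exact hb x y) (fun x x' y => by rw [hL, hL]; exact lx x x' y)
      (fun x y y' => by rw [hL, hL]; exact ly x y y') x y
  · have ev : ((1, 1, 0) : ℝ × ℝ × ℝ) = (1, 0, 0) + (0, 1, 0) := by simp
    have eu : ((-1, 1, 0) : ℝ × ℝ × ℝ) = (0, 1, 0) - (1, 0, 0) := by simp
    have hsum : ∀ x y, fderiv ℝ (fderiv ℝ ps) (x - y, x + y, t) (1, 1, 0) (1, 1, 0) / 2 +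
        fderiv ℝ (fderiv ℝ ps) (x - y, x + y, t) (-1, 1, 0) (-1, 1, 0) / 2 = th (x - y, x + y, t) := by
      intro x y
      rw [← hL, ev, eu]
      simp only [map_add, map_sub, add_apply, sub_apply]
      ring
    have tri : ∀ x y x' y' : ℝ, |th (x, y, t) - th (x', y', t)| ≤ G * |x - x'| + G * |y - y'| := by
      intro x y x' y'
      exact (abs_sub_le _ (th (x', y, t)) _).trans (add_le_add (lx _ _ _) (ly _ _ _))
    have key := aux_elliptic (G := 2 * G) (F := fun x y => ps (x - y, x + y, t) / 2)
      (Fx := fun x y => fderiv ℝ ps (x - y, x + y, t) (1, 1, 0) / 2)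
      (Fy := fun x y => fderiv ℝ ps (x - y, x + y, t) (-1, 1, 0) / 2)
      (Fxx := fun x y => fderiv ℝ (fderiv ℝ ps) (x - y, x + y, t) (1, 1, 0) (1, 1, 0) / 2)
      (Fyy := fun x y => fderiv ℝ (fderiv ℝ ps) (x - y, x + y, t) (-1, 1, 0) (-1, 1, 0) / 2)
      (Fxy := fun x y => fderiv ℝ (fderiv ℝ ps) (x - y, x + y, t) (-1, 1, 0) (1, 1, 0) / 2)
      (by linarith) ((hcont _ _ (continuous_fst.sub continuous_snd) (continuous_fst.add continuous_snd)).div_const 2)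
      (fun x y => (aux_line hΩ hps (g3 x y) (mem _ _)).div_const 2)
      (fun x y => (aux_line2 hΩ hps (g3 x y) (mem _ _) _).div_const 2)
      (fun x y => (aux_line hΩ hps (g4 x y) (mem _ _)).div_const 2)
      (fun x y => (aux_line2 hΩ hps (g4 x y) (mem _ _) _).div_const 2)
      (fun x y => (aux_line2 hΩ hps (g4 x y) (mem _ _) _).div_const 2)
      (fun x y => by
        rw [show x + 2 * π - y = x - y + 2 * π by ring, show x + 2 * π + y = x + y + 2 * π by ring, px, py])
      (fun x y => by
        rw [← px (x - (y + 2 * π)), show x - (y + 2 * π) + 2 * π = x - y by ring,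
          show x + (y + 2 * π) = x + y + 2 * π by ring, py])
      (fun x y => by rw [hsum]; exact hb _ _)
      (fun x x' y => by
        rw [hsum, hsum]
        refine (tri _ _ _ _).trans (le_of_eq ?_)
        rw [show x - y - (x' - y) = x - x' by ring, show x + y - (x' + y) = x - x' by ring]; ring)
      (fun x y y' => by
        rw [hsum, hsum]
        refine (tri _ _ _ _).trans (le_of_eq ?_)
        rw [show x - y - (x - y') = -(y - y') by ring, show x + y - (x + y') = y - y' by ring, abs_neg]; ring)
      ((x + y) / 2) ((y - x) / 2)
    rw [show (x + y) / 2 - (y - x) / 2 = x by ring, show (x + y) / 2 + (y - x) / 2 = y by ring,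
      ev, eu] at key
    simp only [map_add, map_sub, add_apply, sub_apply] at key
    rw [aux_symm hΩ hps (mem x y) (1, 0, 0) (0, 1, 0), abs_div, abs_two, div_le_iff₀ two_pos] at key
    refine le_trans (le_of_eq ?_) (key.trans (le_of_eq ?_))
    · congr 1; ring
    · ring


theorem aux_grid (T t x y : ℝ) :
    HasDerivAt (fun x => ((x, y, t) : ℝ × ℝ × ℝ)) (1, 0, 0) x ∧
    HasDerivAt (fun y => ((x, y, t) : ℝ × ℝ × ℝ)) (0, 1, 0) y ∧
    HasDerivAt (fun t => ((x, y, t) : ℝ × ℝ × ℝ)) (0, 0, 1) t :=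
  ⟨(hasDerivAt_id x).prodMk ((hasDerivAt_const x y).prodMk (hasDerivAt_const x t)),
   (hasDerivAt_const y x).prodMk ((hasDerivAt_id y).prodMk (hasDerivAt_const y t)),
   (hasDerivAt_const t x).prodMk ((hasDerivAt_const t y).prodMk (hasDerivAt_id t))⟩

/-- continuity of the spatial derivatives on the closed slab -/
theorem aux_cont {T : ℝ} (hT : 0 < T) {θ : ℝ → ℝ → ℝ → ℝ}
    (hθ : ContDiffOn ℝ (⊤ : ℕ∞) (fun p : ℝ × ℝ × ℝ => θ p.1 p.2.1 p.2.2)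
      {p : ℝ × ℝ × ℝ | p.2.2 ∈ Icc 0 T}) :
    ContinuousOn (fun p : ℝ × ℝ × ℝ => pX θ p.1 p.2.1 p.2.2) {p : ℝ × ℝ × ℝ | p.2.2 ∈ Icc 0 T} ∧
    ContinuousOn (fun p : ℝ × ℝ × ℝ => pY θ p.1 p.2.1 p.2.2) {p : ℝ × ℝ × ℝ | p.2.2 ∈ Icc 0 T} := by
  set S := {p : ℝ × ℝ × ℝ | p.2.2 ∈ Icc 0 T} with hS
  have hSe : S = (univ : Set ℝ) ×ˢ (univ : Set ℝ) ×ˢ Icc 0 T := by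
    ext p; simp [hS]
  have hu : UniqueDiffOn ℝ S := by
    rw [hSe]
    exact uniqueDiffOn_univ.prod (uniqueDiffOn_univ.prod (uniqueDiffOn_Icc hT))
  have hc := hθ.continuousOn_fderivWithin hu (by simp)
  have hd : ∀ p ∈ S, HasFDerivWithinAt (fun p : ℝ × ℝ × ℝ => θ p.1 p.2.1 p.2.2)
      (fderivWithin ℝ (fun p : ℝ × ℝ × ℝ => θ p.1 p.2.1 p.2.2) S p) S p := fun p hp =>
    ((hθ.differentiableOn (by simp)) p hp).hasFDerivWithinAt
  constructor
  · refine (hc.clm_apply (continuousOn_const (c := ((1, 0, 0) : ℝ × ℝ × ℝ)))).congr ?_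
    rintro ⟨x, y, t⟩ hp
    have := (hd (x, y, t) hp).comp_hasDerivWithinAt (s := univ) (f := fun x => ((x, y, t) : ℝ × ℝ × ℝ)) x
      (aux_grid T t x y).1.hasDerivWithinAt (fun _ _ => hp)
    exact (hasDerivWithinAt_univ.1 this).deriv
  · refine (hc.clm_apply (continuousOn_const (c := ((0, 1, 0) : ℝ × ℝ × ℝ)))).congr ?_
    rintro ⟨x, y, t⟩ hp
    have := (hd (x, y, t) hp).comp_hasDerivWithinAt (s := univ) (f := fun y => ((x, y, t) : ℝ × ℝ × ℝ)) y
      (aux_grid T t x y).2.1.hasDerivWithinAt (fun _ _ => hp)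
    exact (hasDerivWithinAt_univ.1 this).deriv

theorem aux_periodic {θ : ℝ → ℝ → ℝ → ℝ}
    (h : ∀ x y t, θ (x + 2 * π) y t = θ x y t ∧ θ x (y + 2 * π) t = θ x y t) (x y t : ℝ) :
    (pX θ (x + 2 * π) y t = pX θ x y t ∧ pX θ x (y + 2 * π) t = pX θ x y t) ∧
    (pY θ (x + 2 * π) y t = pY θ x y t ∧ pY θ x (y + 2 * π) t = pY θ x y t) := by
  refine ⟨⟨?_, ?_⟩, ?_, ?_⟩
  · unfold pX
    rw [← deriv_comp_add_const]
    simp only [(h _ _ _).1]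
  · unfold pX
    simp only [(h _ _ _).2]
  · unfold pY
    simp only [(h _ _ _).1]
  · unfold pY
    rw [← deriv_comp_add_const]
    simp only [(h _ _ _).2]

theorem aux_interior {T t : ℝ} (ht : t ∈ Ioo 0 T) {θ : ℝ → ℝ → ℝ → ℝ}
    (hθ : ContDiffOn ℝ (⊤ : ℕ∞) (fun p : ℝ × ℝ × ℝ => θ p.1 p.2.1 p.2.2)
      {p : ℝ × ℝ × ℝ | p.2.2 ∈ Ioo 0 T}) (x y : ℝ) :
    HasDerivAt (fun x => θ x y t) (pX θ x y t) x ∧ HasDerivAt (fun y => θ x y t) (pY θ x y t) y ∧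
    pX θ x y t = fderiv ℝ (fun p : ℝ × ℝ × ℝ => θ p.1 p.2.1 p.2.2) (x, y, t) (1, 0, 0) ∧
    pY θ x y t = fderiv ℝ (fun p : ℝ × ℝ × ℝ => θ p.1 p.2.1 p.2.2) (x, y, t) (0, 1, 0) ∧
    HasDerivAt (fun t => θ x y t)
      (fderiv ℝ (fun p : ℝ × ℝ × ℝ => θ p.1 p.2.1 p.2.2) (x, y, t) (0, 0, 1)) t := by
  have hΩ : IsOpen {p : ℝ × ℝ × ℝ | p.2.2 ∈ Ioo 0 T} :=
    isOpen_Ioo.preimage (continuous_snd.comp continuous_snd)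
  obtain ⟨g1, g2, g3⟩ := aux_grid T t x y
  have h1 := aux_line hΩ hθ g1 ht
  have h2 := aux_line hΩ hθ g2 ht
  have h3 := aux_line hΩ hθ g3 ht
  have e1 : pX θ x y t = _ := h1.deriv
  have e2 : pY θ x y t = _ := h2.deriv
  refine ⟨?_, ?_, e1, e2, h3⟩
  · rw [e1]; exact h1
  · rw [e2]; exact h2

/-- Maximum principle for the vorticity. -/
theorem aux_max_principle {T : ℝ} {θ ψ : ℝ → ℝ → ℝ → ℝ}
    (hE : IsEulerOnTorus T θ ψ) (h0 : ∀ x y, |θ x y 0| ≤ 1) :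
    ∀ t, 0 ≤ t → t < T → ∀ x y, |θ x y t| ≤ 1 := by
  obtain ⟨hθ, hψ, perθ, perψ, -, hL, hev⟩ := hE
  have hθ' : ContDiffOn ℝ (⊤ : ℕ∞) (fun p : ℝ × ℝ × ℝ => θ p.1 p.2.1 p.2.2)
      {p : ℝ × ℝ × ℝ | p.2.2 ∈ Ioo 0 T} := hθ.mono fun p hp => Ioo_subset_Icc_self hp
  intro t ht0 htT
  have main : ∀ σ : ℝ, |σ| = 1 → ∀ ε > 0, ∀ x y, σ * θ x y t ≤ 1 + ε * t := by
    intro σ hσ ε hε x y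
    obtain ⟨x0, y0, hm⟩ := aux_parabolic (H := fun x y s => σ * θ x y s - ε * s) ht0
      (by
        refine ContinuousOn.sub (continuousOn_const.mul (hθ.continuousOn.mono ?_)) (by fun_prop)
        exact fun p hp => ⟨hp.1, hp.2.trans htT.le⟩)
      (fun x y s _ => by simp only [(perθ _ _ _).1]) (fun x y s _ => by simp only [(perθ _ _ _).2])
      (by
        intro x0 y0 t0 ht0' hmax
        have hI : t0 ∈ Ioo 0 T := ⟨ht0'.1, ht0'.2.trans_lt htT⟩
        obtain ⟨dx, dy, -, -, dt⟩ := aux_interior hI hθ' x0 y0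
        have hσ0 : σ ≠ 0 := by rintro rfl; simp at hσ
        have z1 : σ * pX θ x0 y0 t0 = 0 := by
          refine IsLocalMax.hasDerivAt_eq_zero (f := fun x => σ * θ x y0 t0) ?_ (dx.const_mul σ)
          exact Filter.Eventually.of_forall fun x => by have := hmax x y0; simp only at this ⊢; linarith
        have z2 : σ * pY θ x0 y0 t0 = 0 := by
          refine IsLocalMax.hasDerivAt_eq_zero (f := fun y => σ * θ x0 y t0) ?_ (dy.const_mul σ)
          exact Filter.Eventually.of_forall fun y => by have := hmax x0 y; simp only at this ⊢; linarith
        have z1' : pX θ x0 y0 t0 = 0 := by simpa [hσ0] using z1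
        have z2' : pY θ x0 y0 t0 = 0 := by simpa [hσ0] using z2
        have e := hev x0 y0 t0 (Ioo_subset_Icc_self hI)
        rw [derivWithin_of_mem_nhds (Icc_mem_nhds hI.1 hI.2), dt.deriv, z1', z2'] at e
        rw [e] at dt
        refine ⟨-ε, by linarith, ?_⟩
        exact ((dt.const_mul σ).sub ((hasDerivAt_id t0).const_mul ε)).congr_deriv (by simp))
    have h1 := hm x y t ⟨ht0, le_rfl⟩
    have h2 : σ * θ x0 y0 0 ≤ 1 := by
      refine (le_abs_self _).trans ?_
      rw [abs_mul, hσ, one_mul]; exact h0 x0 y0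
    linarith
  intro x y
  have lim : ∀ a : ℝ, (∀ ε > 0, a ≤ 1 + ε * t) → a ≤ 1 := by
    intro a ha
    refine le_of_forall_pos_le_add fun ε hε => ?_
    refine (ha (ε / (t + 1)) (by positivity)).trans ?_
    have : ε / (t + 1) * t ≤ ε := by
      rw [div_mul_eq_mul_div, div_le_iff₀ (by linarith)]; nlinarith
    linarith
  rw [abs_le]
  constructor
  · have := lim _ (fun ε hε => main (-1) (by simp) ε hε x y)
    linarith
  · have := lim _ (fun ε hε => main 1 (by simp) ε hε x y)
    linarith

theorem aux_alg {T1 T2 P1 P2 B11 B12 B22 C11 C12 C22 N g : ℝ} (hg2 : g = T1 ^ 2 + T2 ^ 2)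
    (H1 : |C12| ≤ 2 * N) (H2 : |C22 - C11| ≤ 4 * N)
    (z1 : 2 * T1 * B11 + 2 * T2 * B12 = 0) (z2 : 2 * T1 * B12 + 2 * T2 * B22 = 0) :
    2 * T1 * (B11 * P2 + T1 * C12 - (B12 * P1 + T2 * C11)) +
      2 * T2 * (B12 * P2 + T1 * C22 - (B22 * P1 + T2 * C12)) ≤ g * (8 * N) := by
  have hg0 : 0 ≤ g := by rw [hg2]; positivity
  have r1 : (T1 ^ 2 - T2 ^ 2) * C12 ≤ g * (2 * N) := by
    refine (le_abs_self _).trans ?_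
    rw [abs_mul]
    refine mul_le_mul ?_ H1 (abs_nonneg _) hg0
    rw [abs_le, hg2]
    constructor <;> linarith [sq_nonneg T1, sq_nonneg T2]
  have r2 : (2 * T1 * T2) * (C22 - C11) ≤ g * (4 * N) := by
    refine (le_abs_self _).trans ?_
    rw [abs_mul]
    refine mul_le_mul ?_ H2 (abs_nonneg _) hg0
    rw [abs_le, hg2]
    constructor <;> nlinarith [sq_nonneg (T1 - T2), sq_nonneg (T1 + T2)]
  have id1 : 2 * T1 * (B11 * P2 + T1 * C12 - (B12 * P1 + T2 * C11)) +
      2 * T2 * (B12 * P2 + T1 * C22 - (B22 * P1 + T2 * C12)) =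
      P2 * (2 * T1 * B11 + 2 * T2 * B12) - P1 * (2 * T1 * B12 + 2 * T2 * B22) +
      2 * ((T1 ^ 2 - T2 ^ 2) * C12) + (2 * T1 * T2) * (C22 - C11) := by ring
  rw [z1, z2] at id1
  linarith

/-- Growth of the gradient at a spatial maximum. -/
theorem aux_growth {T : ℝ} {θ ψ : ℝ → ℝ → ℝ → ℝ}
    (hE : IsEulerOnTorus T θ ψ) {t : ℝ} (ht : t ∈ Ioo 0 T) (hb : ∀ x y, |θ x y t| ≤ 1) {x0 y0 : ℝ}
    (hmax : ∀ x y, pX θ x y t ^ 2 + pY θ x y t ^ 2 ≤ pX θ x0 y0 t ^ 2 + pY θ x0 y0 t ^ 2) :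
    ∃ d, HasDerivAt (fun s => pX θ x0 y0 s ^ 2 + pY θ x0 y0 s ^ 2) d t ∧
      d ≤ (8 * log ((2 * π + 1) * 2) + 4) *
        log (exp 1 + (pX θ x0 y0 t ^ 2 + pY θ x0 y0 t ^ 2)) *
        (exp 1 + (pX θ x0 y0 t ^ 2 + pY θ x0 y0 t ^ 2)) := by
  obtain ⟨hθ, hψ, perθ, perψ, -, hL, hev⟩ := hE
  have hθ' : ContDiffOn ℝ (⊤ : ℕ∞) (fun p : ℝ × ℝ × ℝ => θ p.1 p.2.1 p.2.2)
      {p : ℝ × ℝ × ℝ | p.2.2 ∈ Ioo 0 T} := hθ.mono fun p hp => Ioo_subset_Icc_self hp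
  have hψ' : ContDiffOn ℝ (⊤ : ℕ∞) (fun p : ℝ × ℝ × ℝ => ψ p.1 p.2.1 p.2.2)
      {p : ℝ × ℝ × ℝ | p.2.2 ∈ Ioo 0 T} := hψ.mono fun p hp => Ioo_subset_Icc_self hp
  have hΩ : IsOpen {p : ℝ × ℝ × ℝ | p.2.2 ∈ Ioo 0 T} :=
    isOpen_Ioo.preimage (continuous_snd.comp continuous_snd)
  set th := fun p : ℝ × ℝ × ℝ => θ p.1 p.2.1 p.2.2 with hth
  set ps := fun p : ℝ × ℝ × ℝ => ψ p.1 p.2.1 p.2.2 with hps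
  have eX : ∀ x y, ∀ s ∈ Ioo 0 T, pX θ x y s = fderiv ℝ th (x, y, s) (1, 0, 0) :=
    fun x y s hs => (aux_interior hs hθ' x y).2.2.1
  have eY : ∀ x y, ∀ s ∈ Ioo 0 T, pY θ x y s = fderiv ℝ th (x, y, s) (0, 1, 0) :=
    fun x y s hs => (aux_interior hs hθ' x y).2.2.2.1
  have fX : ∀ x y, ∀ s ∈ Ioo 0 T, pX ψ x y s = fderiv ℝ ps (x, y, s) (1, 0, 0) :=
    fun x y s hs => (aux_interior hs hψ' x y).2.2.1
  have fY : ∀ x y, ∀ s ∈ Ioo 0 T, pY ψ x y s = fderiv ℝ ps (x, y, s) (0, 1, 0) :=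
    fun x y s hs => (aux_interior hs hψ' x y).2.2.2.1
  have ev : ∀ x y, fderiv ℝ th (x, y, t) (0, 0, 1) =
      fderiv ℝ th (x, y, t) (1, 0, 0) * fderiv ℝ ps (x, y, t) (0, 1, 0) -
      fderiv ℝ th (x, y, t) (0, 1, 0) * fderiv ℝ ps (x, y, t) (1, 0, 0) := by
    intro x y
    have e := hev x y t (Ioo_subset_Icc_self ht)
    rw [derivWithin_of_mem_nhds (Icc_mem_nhds ht.1 ht.2),
      (aux_interior ht hθ' x y).2.2.2.2.deriv, eX _ _ _ ht, eY _ _ _ ht, fX _ _ _ ht, fY _ _ _ ht] at e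
    exact e
  obtain ⟨g1, g2, g3⟩ := aux_grid T t x0 y0
  -- derivatives of the gradient components
  have a1 := fun v => aux_line2 hΩ hθ' g1 ht v
  have a2 := fun v => aux_line2 hΩ hθ' g2 ht v
  have a3 := fun v => aux_line2 hΩ hθ' g3 ht v
  have c1 := fun v => aux_line2 hΩ hψ' g1 ht v
  have c2 := fun v => aux_line2 hΩ hψ' g2 ht v
  have sB := aux_symm hΩ hθ' (q := (x0, y0, t)) ht
  have sC := aux_symm hΩ hψ' (q := (x0, y0, t)) ht
  -- Laplacian
  have hLap : ∀ x y, fderiv ℝ (fderiv ℝ ps) (x, y, t) (1, 0, 0) (1, 0, 0) +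
      fderiv ℝ (fderiv ℝ ps) (x, y, t) (0, 1, 0) (0, 1, 0) = th (x, y, t) := by
    intro x y
    have h := hL x y t (Ioo_subset_Icc_self ht)
    obtain ⟨k1, k2, -⟩ := aux_grid T t x y
    have h1 : pXX ψ x y t = fderiv ℝ (fderiv ℝ ps) (x, y, t) (1, 0, 0) (1, 0, 0) := by
      unfold pXX
      rw [show (fun x' => pX ψ x' y t) = fun x' => fderiv ℝ ps (x', y, t) (1, 0, 0) from
        funext fun x' => fX _ _ _ ht]
      exact (aux_line2 hΩ hψ' k1 ht _).deriv
    have h2 : pYY ψ x y t = fderiv ℝ (fderiv ℝ ps) (x, y, t) (0, 1, 0) (0, 1, 0) := by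
      unfold pYY
      rw [show (fun y' => pY ψ x y' t) = fun y' => fderiv ℝ ps (x, y', t) (0, 1, 0) from
        funext fun y' => fY _ _ _ ht]
      exact (aux_line2 hΩ hψ' k2 ht _).deriv
    rw [← h1, ← h2]; exact h
  set g := pX θ x0 y0 t ^ 2 + pY θ x0 y0 t ^ 2 with hg
  have hg0 : 0 ≤ g := by positivity
  have he1 : 1 ≤ exp 1 := Real.one_le_exp (by norm_num)
  set G := √(exp 1 + g) with hGdef
  have hG1 : 1 ≤ G := by rw [hGdef, Real.one_le_sqrt]; linarith
  have hbX : ∀ x y, |fderiv ℝ th (x, y, t) (1, 0, 0)| ≤ G := by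
    intro x y
    rw [← eX _ _ _ ht]
    refine Real.abs_le_sqrt ?_
    have := hmax x y
    nlinarith [sq_nonneg (pY θ x y t)]
  have hbY : ∀ x y, |fderiv ℝ th (x, y, t) (0, 1, 0)| ≤ G := by
    intro x y
    rw [← eY _ _ _ ht]
    refine Real.abs_le_sqrt ?_
    have := hmax x y
    nlinarith [sq_nonneg (pX θ x y t)]
  obtain ⟨H1, H2⟩ := aux_hess hG1 ht hθ' hψ' (fun x y => (perψ x y t).1) (fun x y => (perψ x y t).2)
    hLap hb hbX hbY x0 y0
  -- spatial criticality
  have hmax' : ∀ x y, fderiv ℝ th (x, y, t) (1, 0, 0) ^ 2 + fderiv ℝ th (x, y, t) (0, 1, 0) ^ 2 ≤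
      fderiv ℝ th (x0, y0, t) (1, 0, 0) ^ 2 + fderiv ℝ th (x0, y0, t) (0, 1, 0) ^ 2 := by
    intro x y
    rw [← eX _ _ _ ht, ← eY _ _ _ ht, ← eX _ _ _ ht, ← eY _ _ _ ht]
    exact hmax x y
  have z1 := IsLocalMax.hasDerivAt_eq_zero
    (f := fun x => fderiv ℝ th (x, y0, t) (1, 0, 0) ^ 2 + fderiv ℝ th (x, y0, t) (0, 1, 0) ^ 2)
    (Filter.Eventually.of_forall fun x => hmax' x y0) (((a1 (1, 0, 0)).pow 2).add ((a1 (0, 1, 0)).pow 2))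
  have z2 := IsLocalMax.hasDerivAt_eq_zero
    (f := fun y => fderiv ℝ th (x0, y, t) (1, 0, 0) ^ 2 + fderiv ℝ th (x0, y, t) (0, 1, 0) ^ 2)
    (Filter.Eventually.of_forall fun y => hmax' x0 y) (((a2 (1, 0, 0)).pow 2).add ((a2 (0, 1, 0)).pow 2))
  -- differentiated equation
  have q1 := (a1 (0, 0, 1)).unique ((((a1 (1, 0, 0)).mul (c1 (0, 1, 0))).sub
    ((a1 (0, 1, 0)).mul (c1 (1, 0, 0)))).congr_of_eventuallyEq
      (Filter.Eventually.of_forall fun x => ev x y0))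
  have q2 := (a2 (0, 0, 1)).unique ((((a2 (1, 0, 0)).mul (c2 (0, 1, 0))).sub
    ((a2 (0, 1, 0)).mul (c2 (1, 0, 0)))).congr_of_eventuallyEq
      (Filter.Eventually.of_forall fun y => ev x0 y))
  have hd := ((a3 (1, 0, 0)).pow 2).add ((a3 (0, 1, 0)).pow 2)
  refine ⟨_, hd.congr_of_eventuallyEq ?_, ?_⟩
  · filter_upwards [Ioo_mem_nhds ht.1 ht.2] with s hs
    simp only [Pi.add_apply, Pi.pow_apply]
    rw [eX _ _ _ hs, eY _ _ _ hs]
  rw [sB (0, 0, 1) (1, 0, 0), sB (0, 0, 1) (0, 1, 0), q1, q2]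
  rw [sB (0, 1, 0) (1, 0, 0)] at z2 ⊢
  rw [sC (0, 1, 0) (1, 0, 0)] at H1 ⊢
  have hg' : g = fderiv ℝ th (x0, y0, t) (1, 0, 0) ^ 2 + fderiv ℝ th (x0, y0, t) (0, 1, 0) ^ 2 := by
    rw [hg, eX _ _ _ ht, eY _ _ _ ht]
  have hG0 : 0 < G := by linarith
  have hpi := Real.pi_pos
  have hℓ : log G = log (exp 1 + g) / 2 := by rw [hGdef, Real.log_sqrt (by linarith)]
  have hℓ1 : 1 ≤ log (exp 1 + g) := by
    have := Real.log_le_log (Real.exp_pos 1) (show exp 1 ≤ exp 1 + g by linarith)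
    rwa [Real.log_exp] at this
  set A := log ((2 * π + 1) * 2) with hA
  have hA0 : 0 ≤ A := Real.log_nonneg (by linarith)
  have l1 : log ((2 * π + 1) * (2 * G)) = A + log (exp 1 + g) / 2 := by
    rw [← mul_assoc, Real.log_mul (by positivity) (by positivity), hℓ]
  have l2 : log ((2 * π + 1) * G) ≤ A + log (exp 1 + g) / 2 := by
    rw [← l1]
    exact Real.log_le_log (by positivity) (by gcongr; linarith)
  rw [l1] at H2
  set ℓ := log (exp 1 + g) with hℓd
  replace H1 : _ ≤ 2 * (A + ℓ / 2) := H1.trans (by linarith)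
  have fin : g * (8 * (A + ℓ / 2)) ≤ (8 * A + 4) * ℓ * (exp 1 + g) := by
    have h1 : 8 * (A + ℓ / 2) ≤ (8 * A + 4) * ℓ := by nlinarith
    have h2 : 0 ≤ (8 * A + 4) * ℓ := by positivity
    nlinarith [mul_le_mul_of_nonneg_left h1 hg0]
  refine le_trans ?_ fin
  simp only [Pi.pow_apply, Pi.mul_apply, Nat.cast_ofNat, Nat.add_one_sub_one, pow_one] at z1 z2 ⊢
  exact aux_alg hg' H1 H2 z1 z2

/-- Double exponential upper bound for the vorticity gradient: if `‖θ(·,0)‖_∞ ≤ 1`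
then `‖∇θ(·,t)‖_∞ ≤ exp(C (1 + log⁺ ‖∇θ(·,0)‖_∞) e^{Ct})`. -/
theorem vorticity_gradient_double_exponential_bound :
    ∃ C : ℝ, 0 < C ∧
      ∀ (T : ℝ) (θ ψ : ℝ → ℝ → ℝ → ℝ), 0 < T → IsEulerOnTorus T θ ψ →
        supNorm (fun x y => θ x y 0) ≤ 1 →
        ∀ t ∈ Icc (0:ℝ) T,
          gradSupNorm θ t ≤
            Real.exp (C * (1 + max (Real.log (gradSupNorm θ 0)) 0) * Real.exp (C * t)) := by
  have hpi := Real.pi_pos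
  set K := 8 * log ((2 * π + 1) * 2) + 4 with hK
  have hK0 : 4 ≤ K := by
    have : 0 ≤ log ((2 * π + 1) * 2) := Real.log_nonneg (by linarith)
    linarith
  refine ⟨K + 1, by linarith, ?_⟩
  intro T θ ψ hT hE h0
  have hE' := hE
  obtain ⟨hθ, hψ, perθ, perψ, -, hL, hev⟩ := hE'
  obtain ⟨cX, cY⟩ := aux_cont hT hθ
  have hg0 : ∀ x y s, 0 ≤ pX θ x y s ^ 2 + pY θ x y s ^ 2 := fun x y s => by positivity
  have he1 : 1 ≤ exp 1 := Real.one_le_exp (by norm_num)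
  -- initial bounds
  have b0 : ∀ x y, |θ x y 0| ≤ 1 := by
    intro x y
    refine le_trans ?_ h0
    refine le_ciSup (f := fun p : ℝ × ℝ => |θ p.1 p.2 0|) ?_ (x, y)
    obtain ⟨x1, y1, t1, -, hm⟩ := aux_exists_max (H := fun x y s => |θ x y s|) hT.le
      hθ.continuousOn.abs (fun x y s _ => by rw [(perθ _ _ _).1]) (fun x y s _ => by rw [(perθ _ _ _).2])
    refine ⟨|θ x1 y1 t1|, ?_⟩
    rintro _ ⟨p, rfl⟩
    exact hm p.1 p.2 0 ⟨le_rfl, hT.le⟩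
  have cG : ContinuousOn (fun p : ℝ × ℝ × ℝ => pX θ p.1 p.2.1 p.2.2 ^ 2 + pY θ p.1 p.2.1 p.2.2 ^ 2)
      {p : ℝ × ℝ × ℝ | p.2.2 ∈ Icc 0 T} := (cX.pow 2).add (cY.pow 2)
  have perX : ∀ x y s, pX θ (x + 2 * π) y s ^ 2 + pY θ (x + 2 * π) y s ^ 2 = pX θ x y s ^ 2 + pY θ x y s ^ 2 :=
    fun x y s => by rw [(aux_periodic perθ x y s).1.1, (aux_periodic perθ x y s).2.1]
  have perY : ∀ x y s, pX θ x (y + 2 * π) s ^ 2 + pY θ x (y + 2 * π) s ^ 2 = pX θ x y s ^ 2 + pY θ x y s ^ 2 :=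
    fun x y s => by rw [(aux_periodic perθ x y s).1.2, (aux_periodic perθ x y s).2.2]
  have g0 : ∀ x y, √(pX θ x y 0 ^ 2 + pY θ x y 0 ^ 2) ≤ gradSupNorm θ 0 := by
    intro x y
    refine le_ciSup (f := fun p : ℝ × ℝ => √(pX θ p.1 p.2 0 ^ 2 + pY θ p.1 p.2 0 ^ 2)) ?_ (x, y)
    obtain ⟨x1, y1, t1, -, hm⟩ := aux_exists_max (H := fun x y s => pX θ x y s ^ 2 + pY θ x y s ^ 2) hT.le
      cG (fun x y s _ => perX x y s) (fun x y s _ => perY x y s)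
    refine ⟨√(pX θ x1 y1 t1 ^ 2 + pY θ x1 y1 t1 ^ 2), ?_⟩
    rintro _ ⟨p, rfl⟩
    exact Real.sqrt_le_sqrt (hm p.1 p.2 0 ⟨le_rfl, hT.le⟩)
  set m := max (log (gradSupNorm θ 0)) 0 with hm
  have hm0 : 0 ≤ m := le_max_right _ _
  have hstart : ∀ x y, log (exp 1 + (pX θ x y 0 ^ 2 + pY θ x y 0 ^ 2)) ≤ 2 * (1 + m) := by
    intro x y
    have hs0 : 0 ≤ √(pX θ x y 0 ^ 2 + pY θ x y 0 ^ 2) := Real.sqrt_nonneg _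
    have h1 : √(pX θ x y 0 ^ 2 + pY θ x y 0 ^ 2) ≤ exp m := by
      rcases eq_or_lt_of_le (hs0.trans (g0 x y)) with h | h
      · rw [← h] at g0
        exact (g0 x y).trans (Real.exp_pos _).le
      · refine (g0 x y).trans ?_
        rw [← Real.log_le_iff_le_exp h]
        exact le_max_left _ _
    have h2 : pX θ x y 0 ^ 2 + pY θ x y 0 ^ 2 ≤ exp m ^ 2 := by
      rw [← Real.sq_sqrt (hg0 x y 0)]
      gcongr
    rw [Real.log_le_iff_le_exp (by linarith [hg0 x y 0])]
    have h3 : exp (2 * (1 + m)) = exp 1 ^ 2 * exp m ^ 2 := by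
      rw [← mul_pow, ← Real.exp_add, ← Real.exp_nat_mul]; norm_num
    have h4 : 1 ≤ exp m := Real.one_le_exp hm0
    have h5 : 2 ≤ exp 1 := by have := Real.add_one_le_exp 1; linarith
    have h6 : 1 ≤ exp m ^ 2 := one_le_pow₀ h4
    rw [h3]
    nlinarith [mul_nonneg (sub_nonneg.2 h5) (sub_nonneg.2 h6),
      mul_nonneg (mul_nonneg (sub_nonneg.2 h5) (Real.exp_pos 1).le) (sub_nonneg.2 h6)]
  have bnd := aux_max_principle hE b0
  -- the estimate before the final time
  have main : ∀ t, 0 ≤ t → t < T → ∀ x y, √(pX θ x y t ^ 2 + pY θ x y t ^ 2) ≤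
      exp ((K + 1) * (1 + m) * exp ((K + 1) * t)) := by
    intro t ht htT x y
    obtain ⟨x0, y0, hmx⟩ := aux_parabolic
      (H := fun x y s => exp (-(K + 1) * s) * log (exp 1 + (pX θ x y s ^ 2 + pY θ x y s ^ 2))) ht
      (by
        refine ContinuousOn.mul (by fun_prop) (ContinuousOn.log (continuousOn_const.add (cG.mono ?_)) ?_)
        · exact fun p hp => ⟨hp.1, hp.2.trans htT.le⟩
        · intro p _
          have := hg0 p.1 p.2.1 p.2.2
          positivity)
      (fun x y s _ => by simp only [perX]) (fun x y s _ => by simp only [perY])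
      (by
        intro x0 y0 t0 ht0 hmax
        have hI : t0 ∈ Ioo 0 T := ⟨ht0.1, ht0.2.trans_lt htT⟩
        obtain ⟨d, hd, hdb⟩ := aux_growth hE hI (bnd t0 hI.1.le hI.2) (x0 := x0) (y0 := y0) (by
          intro x y
          have h1 := le_of_mul_le_mul_left (hmax x y) (Real.exp_pos _)
          rw [Real.log_le_log_iff (by linarith [hg0 x y t0]) (by linarith [hg0 x0 y0 t0])] at h1
          linarith)
        have hpos : 0 < exp 1 + (pX θ x0 y0 t0 ^ 2 + pY θ x0 y0 t0 ^ 2) := by linarith [hg0 x0 y0 t0]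
        have hl1 : 1 ≤ log (exp 1 + (pX θ x0 y0 t0 ^ 2 + pY θ x0 y0 t0 ^ 2)) := by
          rw [Real.le_log_iff_exp_le hpos]; linarith [hg0 x0 y0 t0]
        have hlog := (hd.const_add (exp 1)).log hpos.ne'
        have hexp : HasDerivAt (fun s => exp (-(K + 1) * s)) (exp (-(K + 1) * t0) * (-(K + 1) * 1)) t0 :=
          ((hasDerivAt_id t0).const_mul (-(K + 1))).exp
        refine ⟨_, ?_, hexp.mul hlog⟩
        have hq : d / (exp 1 + (pX θ x0 y0 t0 ^ 2 + pY θ x0 y0 t0 ^ 2)) ≤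
            K * log (exp 1 + (pX θ x0 y0 t0 ^ 2 + pY θ x0 y0 t0 ^ 2)) := by
          rw [div_le_iff₀ hpos]; exact hdb
        have hep := Real.exp_pos (-(K + 1) * t0)
        nlinarith [mul_le_mul_of_nonneg_left hq hep.le, mul_pos hep (zero_lt_one.trans_le hl1)])
    have h1 := (hmx x y t ⟨ht, le_rfl⟩)
    simp only [mul_zero, Real.exp_zero, one_mul] at h1
    replace h1 := h1.trans (hstart x0 y0)
    have hpos : 0 < exp 1 + (pX θ x y t ^ 2 + pY θ x y t ^ 2) := by linarith [hg0 x y t]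
    have h2 : log (exp 1 + (pX θ x y t ^ 2 + pY θ x y t ^ 2)) ≤ 2 * (1 + m) * exp ((K + 1) * t) := by
      have := mul_le_mul_of_nonneg_right h1 (Real.exp_pos ((K + 1) * t)).le
      rwa [mul_right_comm, ← Real.exp_add, show -(K + 1) * t + (K + 1) * t = 0 by ring, Real.exp_zero,
        one_mul] at this
    rw [Real.log_le_iff_le_exp hpos] at h2
    rw [Real.sqrt_le_left (Real.exp_pos _).le, ← Real.exp_nat_mul]
    refine le_trans (by linarith) (h2.trans (Real.exp_le_exp.2 ?_))
    have hp : 0 ≤ (1 + m) * exp ((K + 1) * t) := by positivity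
    push_cast
    nlinarith
  have all : ∀ t ∈ Icc 0 T, ∀ x y, √(pX θ x y t ^ 2 + pY θ x y t ^ 2) ≤
      exp ((K + 1) * (1 + m) * exp ((K + 1) * t)) := by
    intro t ht x y
    rcases ht.2.lt_or_eq with h | rfl
    · exact main t ht.1 h x y
    have hc : ContinuousOn (fun s => √(pX θ x y s ^ 2 + pY θ x y s ^ 2)) (Icc 0 t) :=
      (cG.comp (f := fun s : ℝ => ((x, y, s) : ℝ × ℝ × ℝ)) (by fun_prop) (fun s hs => hs)).sqrt
    have hw : Filter.Tendsto (fun s => √(pX θ x y s ^ 2 + pY θ x y s ^ 2)) (nhdsWithin t (Ioo 0 t))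
        (nhds (√(pX θ x y t ^ 2 + pY θ x y t ^ 2))) :=
      (hc t ⟨hT.le, le_rfl⟩).mono_left (nhdsWithin_mono _ Ioo_subset_Icc_self)
    have hr : Filter.Tendsto (fun s => exp ((K + 1) * (1 + m) * exp ((K + 1) * s))) (nhdsWithin t (Ioo 0 t))
        (nhds (exp ((K + 1) * (1 + m) * exp ((K + 1) * t)))) :=
      (Continuous.tendsto (by fun_prop) t).mono_left nhdsWithin_le_nhds
    have : (nhdsWithin t (Ioo 0 t)).NeBot := by
      rw [nhdsWithin_Ioo_eq_nhdsLT hT]; infer_instance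
    refine le_of_tendsto_of_tendsto hw hr ?_
    filter_upwards [self_mem_nhdsWithin] with s hs
    exact main s hs.1.le hs.2 x y
  intro t ht
  exact ciSup_le fun p => all t ht p.1 p.2
end

section
/- There is an absolute constant C > 0 with the following property. Let θ : ℝ² → ℝ be Lipschitz with Lipschitz constant at most L > 0 and satisfy |θ(ξ)| ≤ K for all ξ in the closed unit ball B₁(0) ⊂ ℝ². Then for every r ∈ (0,1): | ∫_{r < ‖ξ‖ < 1} (ξ₁ ξ₂ / ‖ξ‖⁴) · θ(ξ) dξ | ≤ C (1 + K(1 + log⁺ L)). -/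
open Real MeasureTheory Set

/-- The radial majorant. -/
noncomputable def rieszMaj (L K ρ : ℝ) (y : ℝ) : ℝ :=
  (Ioc 0 ρ).indicator (fun y => L / y) y + (Ioc ρ 1).indicator (fun y => K / y ^ 2) y

/-- Reflection in the first axis. -/
noncomputable def rieszRefl : EuclideanSpace ℝ (Fin 2) ≃ₗᵢ[ℝ] EuclideanSpace ℝ (Fin 2) :=
  LinearIsometryEquiv.piLpCongrRight 2
    (fun i : Fin 2 => if i = 0 then LinearIsometryEquiv.refl ℝ ℝ else LinearIsometryEquiv.neg ℝ)

lemma rieszRefl_zero (x : EuclideanSpace ℝ (Fin 2)) : rieszRefl x 0 = x 0 := by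
  simp [rieszRefl]

lemma rieszRefl_one (x : EuclideanSpace ℝ (Fin 2)) : rieszRefl x 1 = - x 1 := by
  simp [rieszRefl]

lemma rieszMaj_mul {L K ρ : ℝ} (hρ : 0 < ρ) : EqOn (fun y => y ^ 1 • rieszMaj L K ρ y)
    (fun y => (Ioc 0 ρ).indicator (fun _ => L) y + (Ioc ρ 1).indicator (fun y => K * y⁻¹) y)
    (Ioi 0) := by
  intro y hy
  have hy : 0 < y := hy
  simp only [rieszMaj, indicator, smul_eq_mul, pow_one, mul_add]
  congr 1
  · split_ifs
    · field_simp
    · simp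
  · split_ifs
    · field_simp
    · simp

lemma riesz_int_left {L ρ : ℝ} : Integrable ((Ioc 0 ρ).indicator (fun _ => L)) :=
  (integrable_indicator_iff measurableSet_Ioc).2 (by simp)

lemma riesz_int_right {K ρ : ℝ} (hρ : 0 < ρ) (h1 : ρ ≤ 1) :
    Integrable ((Ioc ρ 1).indicator (fun y => K * y⁻¹)) := by
  refine (integrable_indicator_iff measurableSet_Ioc).2 ?_
  rw [← intervalIntegrable_iff_integrableOn_Ioc_of_le h1]
  refine IntervalIntegrable.const_mul ?_ _
  refine intervalIntegral.intervalIntegrable_inv (fun x hx => ?_) continuousOn_id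
  rw [uIcc_of_le h1] at hx
  exact (hρ.trans_le hx.1).ne'

lemma rieszMaj_integrable {L K ρ : ℝ} (hρ : 0 < ρ) (h1 : ρ ≤ 1) :
    Integrable (fun x : EuclideanSpace ℝ (Fin 2) => rieszMaj L K ρ ‖x‖) := by
  rw [integrable_fun_norm_addHaar]
  simp only [finrank_euclideanSpace, Fintype.card_fin, Nat.add_one_sub_one]
  rw [integrableOn_congr_fun (rieszMaj_mul hρ) measurableSet_Ioi]
  exact (riesz_int_left.add (riesz_int_right hρ h1)).integrableOn

lemma rieszMaj_integral {L K ρ : ℝ} (hρ : 0 < ρ) (h1 : ρ ≤ 1) :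
    ∫ x : EuclideanSpace ℝ (Fin 2), rieszMaj L K ρ ‖x‖ =
      2 * volume.real (Metric.ball (0 : EuclideanSpace ℝ (Fin 2)) 1) *
        (L * ρ + K * Real.log (1 / ρ)) := by
  rw [integral_fun_norm_addHaar]
  simp only [finrank_euclideanSpace, Fintype.card_fin, Nat.add_one_sub_one]
  rw [setIntegral_congr_fun measurableSet_Ioi (rieszMaj_mul hρ),
    integral_add riesz_int_left.integrableOn (riesz_int_right hρ h1).integrableOn,
    setIntegral_indicator measurableSet_Ioc, setIntegral_indicator measurableSet_Ioc,
    inter_eq_right.2 (fun x hx => hx.1), inter_eq_right.2 (show Ioc ρ 1 ⊆ Ioi 0 from fun x hx => lt_trans hρ hx.1),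
    ← intervalIntegral.integral_of_le h1, intervalIntegral.integral_const_mul,
    integral_inv_of_pos hρ one_pos]
  simp [hρ.le]
  ring

theorem riesz_kernel_log_estimate :
    ∃ C : ℝ, 0 < C ∧
      ∀ (θ : EuclideanSpace ℝ (Fin 2) → ℝ) (L K : ℝ), 0 < L →
        (∀ a b : EuclideanSpace ℝ (Fin 2), |θ a - θ b| ≤ L * ‖a - b‖) →
        (∀ ξ : EuclideanSpace ℝ (Fin 2), ‖ξ‖ ≤ 1 → |θ ξ| ≤ K) →
        ∀ r : ℝ, r ∈ Ioo (0:ℝ) 1 →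
          |∫ ξ in {ξ : EuclideanSpace ℝ (Fin 2) | r < ‖ξ‖ ∧ ‖ξ‖ < 1},
              (ξ 0 * ξ 1 / ‖ξ‖ ^ 4) * θ ξ| ≤
            C * (1 + K * (1 + max (Real.log L) 0)) := by
  set M := volume.real (Metric.ball (0 : EuclideanSpace ℝ (Fin 2)) 1) with hM
  have hM0 : 0 ≤ M := measureReal_nonneg
  refine ⟨2 * M + 1, by positivity, ?_⟩
  intro θ L K hL hlip hK r hr
  have hK0 : 0 ≤ K := (abs_nonneg _).trans (hK 0 (by simp))
  have hlog : 0 ≤ max (Real.log L) 0 := le_max_right _ _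
  set A := {ξ : EuclideanSpace ℝ (Fin 2) | r < ‖ξ‖ ∧ ‖ξ‖ < 1} with hA
  have hAm : MeasurableSet A :=
    (measurableSet_lt measurable_const measurable_norm).inter
      (measurableSet_lt measurable_norm measurable_const)
  rw [← integral_indicator hAm]
  set F := A.indicator (fun ξ => (ξ 0 * ξ 1 / ‖ξ‖ ^ 4) * θ ξ) with hF
  by_cases hint : Integrable F
  swap
  · rw [integral_undef hint]; simp; positivity
  have hmp := rieszRefl.measurePreserving
  have hcomp : ∫ x, F (rieszRefl x) = ∫ x, F x :=
    hmp.integral_comp rieszRefl.toHomeomorph.measurableEmbedding F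
  have hint2 : Integrable (fun x => F (rieszRefl x)) :=
    (hmp.integrable_comp_emb rieszRefl.toHomeomorph.measurableEmbedding).2 hint
  have hsum : ∫ x, F x = ∫ x, (F x + F (rieszRefl x)) / 2 := by
    rw [integral_div, integral_add hint hint2, hcomp]; ring
  obtain ⟨ρ, hρ, h1, hLρ, hlr, hLρ2⟩ : ∃ ρ : ℝ, 0 < ρ ∧ ρ ≤ 1 ∧ L * ρ ≤ 1 ∧
      Real.log (1 / ρ) = max (Real.log L) 0 ∧ True := by
    rcases le_total L 1 with h | h
    · exact ⟨1, one_pos, le_rfl, by linarith, by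
        rw [max_eq_right (Real.log_nonpos hL.le h)]; simp, trivial⟩
    · refine ⟨1 / L, by positivity, (div_le_one hL).2 h, by
        rw [mul_one_div_cancel hL.ne'], ?_, trivial⟩
      rw [max_eq_left (Real.log_nonneg h), one_div_one_div]
  have hbound : ∀ x, ‖(F x + F (rieszRefl x)) / 2‖ ≤ rieszMaj L K ρ ‖x‖ := by
    intro x
    have hRn : ‖rieszRefl x‖ = ‖x‖ := rieszRefl.norm_map x
    by_cases hx : x ∈ A
    · have hRx : rieszRefl x ∈ A := by simpa [hA, hRn] using hx
      have hx0 : 0 < ‖x‖ := hr.1.trans hx.1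
      have hx1 : ‖x‖ ≤ 1 := hx.2.le
      have e : (F x + F (rieszRefl x)) / 2 =
          (x 0 * x 1 / ‖x‖ ^ 4) * ((θ x - θ (rieszRefl x)) / 2) := by
        simp only [hF, indicator_of_mem hx, indicator_of_mem hRx, rieszRefl_zero,
          rieszRefl_one, hRn]
        ring
      have hk : |x 0 * x 1 / ‖x‖ ^ 4| ≤ 1 / ‖x‖ ^ 2 := by
        have h0 : |x 0| ≤ ‖x‖ := PiLp.norm_apply_le x 0
        have h1 : |x 1| ≤ ‖x‖ := PiLp.norm_apply_le x 1
        rw [abs_div, abs_mul, abs_of_pos (by positivity : 0 < ‖x‖ ^ 4),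
          div_le_div_iff₀ (by positivity) (by positivity)]
        calc |x 0| * |x 1| * ‖x‖ ^ 2 ≤ ‖x‖ * ‖x‖ * ‖x‖ ^ 2 := by gcongr
          _ = 1 * ‖x‖ ^ 4 := by ring
      have hd1 : |(θ x - θ (rieszRefl x)) / 2| ≤ K := by
        have := abs_le.1 (hK x hx1)
        have := abs_le.1 (hK (rieszRefl x) (by rw [hRn]; exact hx1))
        rw [abs_le]; constructor <;> linarith
      have hd2 : |(θ x - θ (rieszRefl x)) / 2| ≤ L * ‖x‖ := by
        have h2 := norm_sub_le x (rieszRefl x)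
        rw [hRn] at h2
        have h3 := mul_le_mul_of_nonneg_left h2 hL.le
        have := hlip x (rieszRefl x)
        rw [abs_div, abs_of_pos (two_pos : (0:ℝ) < 2)]
        linarith
      rw [e, Real.norm_eq_abs, abs_mul]
      rcases le_or_gt ‖x‖ ρ with hc | hc
      · have : rieszMaj L K ρ ‖x‖ = L / ‖x‖ := by
          simp [rieszMaj, indicator, hx0, hc, not_lt.2 hc]
        rw [this]
        calc _ ≤ 1 / ‖x‖ ^ 2 * (L * ‖x‖) := by gcongr
          _ = L / ‖x‖ := by field_simp
      · have : rieszMaj L K ρ ‖x‖ = K / ‖x‖ ^ 2 := by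
          simp [rieszMaj, indicator, hx1, hc, not_le.2 hc]
        rw [this]
        calc _ ≤ 1 / ‖x‖ ^ 2 * K := by gcongr
          _ = K / ‖x‖ ^ 2 := by ring
    · have hRx : rieszRefl x ∉ A := by simpa [hA, hRn] using hx
      simp only [hF, indicator_of_notMem hx, indicator_of_notMem hRx]
      simp only [add_zero, zero_div, norm_zero, rieszMaj]
      refine add_nonneg (indicator_nonneg (fun y hy => ?_) _) (indicator_nonneg (fun y hy => ?_) _)
      · exact div_nonneg hL.le hy.1.le
      · positivity
  have key := norm_integral_le_of_norm_le (rieszMaj_integrable (L := L) (K := K) hρ h1)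
    (Filter.Eventually.of_forall hbound)
  rw [← hsum, rieszMaj_integral hρ h1, hlr, ← hM, Real.norm_eq_abs] at key
  refine key.trans ?_
  gcongr
  · linarith
  · linarith
end

section
/- For all real numbers x, y with 0 < x ≤ y: | ∫₀ˣ log(y² + ξ²) dξ − 2x·log y | ≤ 3x. -/
open Real MeasureTheory

/-- For `0 < x ≤ y`, `|∫₀ˣ log(y² + ξ²) dξ − 2x log y| ≤ 3x`. -/
theorem integral_log_asymptotics_x (x y : ℝ) (hx : 0 < x) (hxy : x ≤ y) :
    |(∫ ξ in (0:ℝ)..x, Real.log (y ^ 2 + ξ ^ 2)) - 2 * x * Real.log y| ≤ 3 * x := by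
  have hy : 0 < y := hx.trans_le hxy
  have hc : Continuous fun ξ : ℝ => Real.log (y ^ 2 + ξ ^ 2) := by
    apply Continuous.log
    · fun_prop
    · intro ξ
      positivity
  have e : (∫ ξ in (0:ℝ)..x, Real.log (y ^ 2 + ξ ^ 2)) - 2 * x * Real.log y
      = ∫ ξ in (0:ℝ)..x, (Real.log (y ^ 2 + ξ ^ 2) - 2 * Real.log y) := by
    rw [intervalIntegral.integral_sub (hc.intervalIntegrable _ _)
      (continuous_const.intervalIntegrable _ _), intervalIntegral.integral_const]
    simp only [smul_eq_mul]
    ring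
  have b := intervalIntegral.norm_integral_le_of_norm_le_const (a := 0) (b := x) (C := 3)
    (f := fun ξ : ℝ => Real.log (y ^ 2 + ξ ^ 2) - 2 * Real.log y) (by
      intro ξ hξ
      rw [Set.uIoc_of_le hx.le] at hξ
      obtain ⟨h0, h1⟩ := hξ
      have h2 : 2 * Real.log y = Real.log (y ^ 2) := by
        rw [Real.log_pow]
        norm_num
      have hpos : 0 < y ^ 2 + ξ ^ 2 := by positivity
      have hl : Real.log (y ^ 2) ≤ Real.log (y ^ 2 + ξ ^ 2) :=
        Real.log_le_log (by positivity) (by nlinarith)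
      have hu : Real.log (y ^ 2 + ξ ^ 2) - Real.log (y ^ 2) ≤ 1 := by
        rw [← Real.log_div hpos.ne' (by positivity)]
        have := Real.log_le_sub_one_of_pos (x := (y ^ 2 + ξ ^ 2) / y ^ 2) (by positivity)
        have h3 : (y ^ 2 + ξ ^ 2) / y ^ 2 ≤ 2 := by
          rw [div_le_iff₀ (by positivity)]
          nlinarith
        linarith
      rw [h2, Real.norm_eq_abs, abs_le]
      constructor <;> linarith)
  rw [e]
  rwa [sub_zero, abs_of_pos hx, Real.norm_eq_abs] at b
end

section
/- For all real numbers x, y with 0 < x ≤ y: | ∫₀ʸ log(x² + ξ²) dξ − 2y·log y | ≤ 6y. -/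
open Real MeasureTheory

/-- For `0 < x ≤ y`, `|∫₀ʸ log(x² + ξ²) dξ − 2y log y| ≤ 6y`. -/
theorem integral_log_asymptotics_y (x y : ℝ) (hx : 0 < x) (hxy : x ≤ y) :
    |(∫ ξ in (0:ℝ)..y, Real.log (x ^ 2 + ξ ^ 2)) - 2 * y * Real.log y| ≤ 6 * y := by
  have hy : 0 < y := lt_of_lt_of_le hx hxy
  have hint : IntervalIntegrable (fun ξ : ℝ => Real.log (x ^ 2 + ξ ^ 2)) volume 0 y := by
    apply Continuous.intervalIntegrable
    apply Continuous.log
    · fun_prop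
    · intro ξ
      positivity
  have hlog : IntervalIntegrable (fun ξ : ℝ => 2 * Real.log ξ) volume 0 y :=
    intervalIntegral.intervalIntegrable_log'.const_mul 2
  have lower : (∫ ξ in (0:ℝ)..y, 2 * Real.log ξ) ≤ ∫ ξ in (0:ℝ)..y, Real.log (x ^ 2 + ξ ^ 2) := by
    apply intervalIntegral.integral_mono_on_of_le_Ioo hy.le hlog hint
    intro ξ hξ
    have h0 : 0 < ξ := hξ.1
    have h1 : 2 * Real.log ξ = Real.log (ξ ^ 2) := by
      rw [Real.log_pow]; norm_num
    rw [h1]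
    apply Real.log_le_log (by positivity)
    nlinarith [sq_nonneg x]
  have upper : (∫ ξ in (0:ℝ)..y, Real.log (x ^ 2 + ξ ^ 2)) ≤
      ∫ _ξ in (0:ℝ)..y, (1 + 2 * Real.log y) := by
    apply intervalIntegral.integral_mono_on_of_le_Ioo hy.le hint intervalIntegrable_const
    intro ξ hξ
    have h0 : 0 < ξ := hξ.1
    have h2 : ξ < y := hξ.2
    have h1 : Real.log (2 * y ^ 2) = Real.log 2 + 2 * Real.log y := by
      rw [Real.log_mul (by norm_num) (by positivity), Real.log_pow]; norm_num
    have h3 : Real.log (x ^ 2 + ξ ^ 2) ≤ Real.log (2 * y ^ 2) := by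
      apply Real.log_le_log (by positivity)
      nlinarith
    have h4 := Real.log_two_lt_d9
    linarith
  rw [intervalIntegral.integral_const_mul, integral_log] at lower
  rw [intervalIntegral.integral_const, smul_eq_mul] at upper
  rw [abs_le]
  constructor <;> nlinarith
end

section
/- Let C > 0, t₀ > 0, and let y : [0, t₀] → (0, 1) be differentiable with y(0) = β ∈ (0,1), satisfying for all t ∈ [0, t₀]: −y(t)·(−log y(t) + C) ≤ y'(t) ≤ −y(t)·(−log y(t) − C). Then for all t ∈ [0, t₀]: exp(e^t (log β − C)) ≤ y(t) ≤ exp(e^t (log β + C)). In particular, y decays at a double exponential rate. -/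
open Real Set

/-- Double-exponential contraction along the vertical direction: if `y : [0,t₀] → (0,1)`
is differentiable with `y(0) = β` and
`−y(−log y + C) ≤ y' ≤ −y(−log y − C)`, then
`exp(eᵗ(log β − C)) ≤ y(t) ≤ exp(eᵗ(log β + C))` on `[0,t₀]`. -/
theorem double_exponential_contraction
    (C t₀ β : ℝ) (hC : 0 < C) (ht₀ : 0 < t₀) (hβ : β ∈ Ioo (0:ℝ) 1)
    (y d : ℝ → ℝ)
    (hy0 : y 0 = β)
    (hrange : ∀ t ∈ Icc (0:ℝ) t₀, y t ∈ Ioo (0:ℝ) 1)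
    (hderiv : ∀ t ∈ Icc (0:ℝ) t₀, HasDerivWithinAt y (d t) (Icc 0 t₀) t)
    (hlow : ∀ t ∈ Icc (0:ℝ) t₀, -(y t) * (-Real.log (y t) + C) ≤ d t)
    (hhigh : ∀ t ∈ Icc (0:ℝ) t₀, d t ≤ -(y t) * (-Real.log (y t) - C)) :
    ∀ t ∈ Icc (0:ℝ) t₀,
      Real.exp (Real.exp t * (Real.log β - C)) ≤ y t ∧
      y t ≤ Real.exp (Real.exp t * (Real.log β + C)) := by
  have key : ∀ c : ℝ, ∀ t ∈ Icc (0:ℝ) t₀,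
      HasDerivWithinAt (fun s => Real.exp (-s) * (Real.log (y s) + c))
        (Real.exp (-t) * (d t / y t - Real.log (y t) - c)) (Icc 0 t₀) t := by
    intro c t ht
    have h1 := ((hderiv t ht).log (hrange t ht).1.ne').add_const c
    have h2 := ((hasDerivAt_neg t).exp).hasDerivWithinAt (s := Icc 0 t₀)
    refine (h2.mul h1).congr_deriv ?_
    ring
  have hsub : interior (Icc (0:ℝ) t₀) ⊆ Icc 0 t₀ := interior_subset
  have h0 : (0:ℝ) ∈ Icc (0:ℝ) t₀ := ⟨le_rfl, ht₀.le⟩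
  have hanti : AntitoneOn (fun s => Real.exp (-s) * (Real.log (y s) + C)) (Icc 0 t₀) := by
    refine antitoneOn_of_hasDerivWithinAt_nonpos (convex_Icc 0 t₀)
      (fun t ht => (key C t ht).continuousWithinAt)
      (fun t ht => (key C t (hsub ht)).mono hsub) ?_
    intro t ht
    have hy := (hrange t (hsub ht)).1
    have h : d t / y t ≤ Real.log (y t) + C := by
      rw [div_le_iff₀ hy]
      linarith [hhigh t (hsub ht)]
    exact mul_nonpos_of_nonneg_of_nonpos (Real.exp_pos _).le (by linarith)
  have hmono : MonotoneOn (fun s => Real.exp (-s) * (Real.log (y s) + -C)) (Icc 0 t₀) := by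
    refine monotoneOn_of_hasDerivWithinAt_nonneg (convex_Icc 0 t₀)
      (fun t ht => (key (-C) t ht).continuousWithinAt)
      (fun t ht => (key (-C) t (hsub ht)).mono hsub) ?_
    intro t ht
    have hy := (hrange t (hsub ht)).1
    have h : Real.log (y t) - C ≤ d t / y t := by
      rw [le_div_iff₀ hy]
      linarith [hlow t (hsub ht)]
    exact mul_nonneg (Real.exp_pos _).le (by linarith)
  intro t ht
  have hy := (hrange t ht).1
  have ha := hanti h0 ht ht.1
  have hm := hmono h0 ht ht.1
  simp only [neg_zero, Real.exp_zero, one_mul, hy0] at ha hm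
  have he : Real.exp t * Real.exp (-t) = 1 := by
    rw [← Real.exp_add]; simp
  have ha' := mul_le_mul_of_nonneg_left ha (Real.exp_pos t).le
  have hm' := mul_le_mul_of_nonneg_left hm (Real.exp_pos t).le
  rw [← mul_assoc, he, one_mul] at ha' hm'
  constructor
  · rw [← Real.le_log_iff_exp_le hy]
    linarith
  · rw [← Real.log_le_iff_le_exp hy]
    linarith
end

section
/- Let C, C₁, C₂ > 0 and T > 0. There exists β₁ ∈ (0,1), depending only on C, C₁, C₂ and T, with the following property. Let β ∈ (0, β₁], υ ≥ 0 with υ·(T+1) ≤ β₁, let f₂₁, g, f₁₂ : [0,T] → ℝ be measurable with |f₂₁(s)| ≤ C₁, g(ξ) ≥ 1, and |f₁₂(τ)| ≤ C₂·(υ + exp(e^τ (log β + C))) for all s, ξ, τ ∈ [0,T], let x̂ : [0,T] → ℝ be continuous and satisfy x̂(t) = 1 + ∫₀ᵗ x̂(s) f₂₁(s) ( ∫ₛᵗ f₁₂(τ) exp(−∫ₛ^τ g(ξ) dξ) dτ ) ds, and let f₁₁ : [0,T] → ℝ be integrable with f₁₁(t) ≥ e^t·(−log β − C) for all t ∈ [0,T].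 Define x_α(t) = exp(∫₀ᵗ f₁₁(τ) dτ) · x̂(t). Then x_α(T) ≥ (1/β)^{(e^T − 1)/2}. -/
open Real Set MeasureTheory

/-- Key estimate: the derivative `x_α(t) = exp(∫₀ᵗ f₁₁) x̂(t)` of the horizontal
coordinate of the flow map with respect to the initial horizontal coordinate grows
at the double-exponential rate `(1/β)^{(e^T − 1)/2}`. -/
theorem key_derivative_growth_estimate
    (C C₁ C₂ T : ℝ) (hC : 0 < C) (hC₁ : 0 < C₁) (hC₂ : 0 < C₂) (hT : 0 < T) :
    ∃ β₁ ∈ Ioo (0:ℝ) 1, ∀ (β υ : ℝ), β ∈ Ioc (0:ℝ) β₁ → 0 ≤ υ →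
      υ * (T + 1) ≤ β₁ →
      ∀ f₂₁ g f₁₂ : ℝ → ℝ,
        Measurable f₂₁ → Measurable g → Measurable f₁₂ →
        (∀ s ∈ Icc (0:ℝ) T, |f₂₁ s| ≤ C₁) →
        (∀ ξ ∈ Icc (0:ℝ) T, 1 ≤ g ξ) →
        (∀ τ ∈ Icc (0:ℝ) T,
          |f₁₂ τ| ≤ C₂ * (υ + Real.exp (Real.exp τ * (Real.log β + C)))) →
        ∀ xhat : ℝ → ℝ, ContinuousOn xhat (Icc 0 T) →
          (∀ t ∈ Icc (0:ℝ) T,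
            xhat t = 1 + ∫ s in (0:ℝ)..t, xhat s * f₂₁ s *
              ∫ τ in s..t, f₁₂ τ * Real.exp (-∫ ξ in s..τ, g ξ)) →
          ∀ f₁₁ : ℝ → ℝ, IntegrableOn f₁₁ (Icc 0 T) →
            (∀ t ∈ Icc (0:ℝ) T, Real.exp t * (-Real.log β - C) ≤ f₁₁ t) →
            (1 / β) ^ ((Real.exp T - 1) / 2) ≤
              Real.exp (∫ τ in (0:ℝ)..T, f₁₁ τ) * xhat T := by
  have hA : 0 < 4 * (C₁ * (C₂ * (1 + Real.exp C)) * T ^ 2) := by positivity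
  have hlt : Real.exp (-(2 * C + 2 / T)) < 1 := by
    rw [Real.exp_lt_one_iff]
    have : 0 < 2 * C + 2 / T := by positivity
    linarith
  refine ⟨min (Real.exp (-(2 * C + 2 / T))) (1 / (4 * (C₁ * (C₂ * (1 + Real.exp C)) * T ^ 2))),
    ⟨lt_min (Real.exp_pos _) (by positivity), lt_of_le_of_lt (min_le_left _ _) hlt⟩, ?_⟩
  generalize hb : min (Real.exp (-(2 * C + 2 / T)))
    (1 / (4 * (C₁ * (C₂ * (1 + Real.exp C)) * T ^ 2))) = b
  have hb1 : b ≤ Real.exp (-(2 * C + 2 / T)) := hb ▸ min_le_left _ _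
  have hb2 : b ≤ 1 / (4 * (C₁ * (C₂ * (1 + Real.exp C)) * T ^ 2)) := hb ▸ min_le_right _ _
  rw [le_div_iff₀ hA] at hb2
  intro β υ hβ hυ hυT f₂₁ g f₁₂ _ _ _ h21 hg h12 x hx hxe f₁₁ hint h11
  obtain ⟨hβ0, hβb⟩ := hβ
  have hb0 : 0 < b := lt_of_lt_of_le hβ0 hβb
  have hlog : Real.log β ≤ -(2 * C + 2 / T) := by
    rw [Real.log_le_iff_le_exp hβ0]; exact hβb.trans hb1
  have hT2 : 0 < 2 / T := by positivity
  have hυb : υ ≤ b := by nlinarith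
  -- bound on f₁₂
  have hf12 : ∀ τ ∈ Icc (0:ℝ) T, |f₁₂ τ| ≤ C₂ * (1 + Real.exp C) * b := by
    intro τ hτ
    have h1 : Real.exp (Real.exp τ * (Real.log β + C)) ≤ β * Real.exp C := by
      have : β * Real.exp C = Real.exp (Real.log β + C) := by
        rw [Real.exp_add, Real.exp_log hβ0]
      rw [this, Real.exp_le_exp]
      have h2 : 1 ≤ Real.exp τ := Real.one_le_exp hτ.1
      nlinarith
    have h3 : β * Real.exp C ≤ b * Real.exp C := by gcongr
    calc |f₁₂ τ| ≤ _ := h12 τ hτ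
      _ ≤ C₂ * (b + b * Real.exp C) := by gcongr; exact h1.trans h3
      _ = _ := by ring
  have hK : ∀ t ∈ Icc (0:ℝ) T, ∀ s ∈ Icc (0:ℝ) t,
      |∫ τ in s..t, f₁₂ τ * Real.exp (-∫ ξ in s..τ, g ξ)| ≤ C₂ * (1 + Real.exp C) * b * T := by
    intro t ht s hs
    have h := intervalIntegral.norm_integral_le_of_norm_le_const (a := s) (b := t)
      (f := fun τ => f₁₂ τ * Real.exp (-∫ ξ in s..τ, g ξ)) (C := C₂ * (1 + Real.exp C) * b) ?_
    · rw [Real.norm_eq_abs] at h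
      refine h.trans ?_
      have : |t - s| ≤ T := by
        rw [abs_of_nonneg (by linarith [hs.2])]; linarith [hs.1, ht.2]
      gcongr
    · intro τ hτ
      rw [uIoc_of_le hs.2] at hτ
      have hτT : τ ∈ Icc (0:ℝ) T := ⟨hs.1.trans hτ.1.le, hτ.2.trans ht.2⟩
      have hgi : 0 ≤ ∫ ξ in s..τ, g ξ := by
        apply intervalIntegral.integral_nonneg hτ.1.le
        intro u hu
        linarith [hg u ⟨hs.1.trans hu.1, hu.2.trans hτT.2⟩]
      have he : Real.exp (-∫ ξ in s..τ, g ξ) ≤ 1 := by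
        rw [Real.exp_le_one_iff]; linarith
      rw [Real.norm_eq_abs, abs_mul, abs_of_pos (Real.exp_pos _)]
      calc _ ≤ |f₁₂ τ| * 1 := by gcongr
        _ ≤ _ := by rw [mul_one]; exact hf12 τ hτT
  obtain ⟨t₀, ht₀, hmax⟩ := isCompact_Icc.exists_isMaxOn (nonempty_Icc.2 hT.le) hx.abs
  have hM : ∀ s ∈ Icc (0:ℝ) T, |x s| ≤ |x t₀| := fun s hs => hmax hs
  obtain ⟨M, hMe⟩ : ∃ M, M = |x t₀| := ⟨_, rfl⟩
  rw [← hMe] at hM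
  have hM0 : 0 ≤ M := hMe ▸ abs_nonneg _
  have key : ∀ t ∈ Icc (0:ℝ) T, |x t - 1| ≤ M / 4 := by
    intro t ht
    have h := intervalIntegral.norm_integral_le_of_norm_le_const (a := 0) (b := t)
      (f := fun s => x s * f₂₁ s * ∫ τ in s..t, f₁₂ τ * Real.exp (-∫ ξ in s..τ, g ξ))
      (C := M * C₁ * (C₂ * (1 + Real.exp C) * b * T)) ?_
    · have e : x t - 1 = ∫ s in (0:ℝ)..t, x s * f₂₁ s *
              ∫ τ in s..t, f₁₂ τ * Real.exp (-∫ ξ in s..τ, g ξ) := by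
        rw [hxe t ht]; ring
      rw [e, ← Real.norm_eq_abs]
      refine h.trans ?_
      rw [sub_zero, abs_of_nonneg ht.1]
      calc _ ≤ M * C₁ * (C₂ * (1 + Real.exp C) * b * T) * T := by
            gcongr; exact ht.2
        _ = M / 4 * (b * (4 * (C₁ * (C₂ * (1 + Real.exp C)) * T ^ 2))) := by ring
        _ ≤ M / 4 * 1 := by gcongr
        _ = _ := mul_one _
    · intro s hs
      rw [uIoc_of_le ht.1] at hs
      have hsT : s ∈ Icc (0:ℝ) T := ⟨hs.1.le, hs.2.trans ht.2⟩
      rw [Real.norm_eq_abs, abs_mul, abs_mul]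
      gcongr
      · exact hM s hsT
      · exact h21 s hsT
      · exact hK t ht s ⟨hs.1.le, hs.2⟩
  have hM2 : M ≤ 4 / 3 := by
    have h1 := key t₀ ht₀
    have h2 : |x t₀| ≤ |x t₀ - 1| + 1 := by
      have := abs_add_le (x t₀ - 1) 1
      simpa using this
    linarith
  have hxT : Real.exp (-1) ≤ x T := by
    have h1 := abs_le.1 (key T ⟨hT.le, le_rfl⟩)
    have h2 : Real.exp (-1) ≤ 1 / 2 := by
      rw [Real.exp_neg, ← one_div]
      apply one_div_le_one_div_of_le two_pos
      linarith [Real.add_one_le_exp (1:ℝ)]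
    linarith [h1.1]
  have hI : (Real.exp T - 1) * (-Real.log β - C) ≤ ∫ τ in (0:ℝ)..T, f₁₁ τ := by
    have e : (Real.exp T - 1) * (-Real.log β - C)
        = ∫ t in (0:ℝ)..T, Real.exp t * (-Real.log β - C) := by
      rw [intervalIntegral.integral_mul_const, integral_exp, Real.exp_zero]
    rw [e]
    apply intervalIntegral.integral_mono_on hT.le
    · exact Continuous.intervalIntegrable (by fun_prop) _ _
    · rw [intervalIntegrable_iff_integrableOn_Icc_of_le hT.le]; exact hint
    · exact h11
  have hfin : Real.log (1 / β) * ((Real.exp T - 1) / 2) ≤ (∫ τ in (0:ℝ)..T, f₁₁ τ) + -1 := by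
    rw [one_div, Real.log_inv]
    have h1 : T ≤ Real.exp T - 1 := by linarith [Real.add_one_le_exp T]
    have h2 : 1 / T ≤ -Real.log β / 2 - C := by
      have : 2 / T = 2 * (1 / T) := by ring
      linarith
    have h3 : T * (1 / T) ≤ (Real.exp T - 1) * (-Real.log β / 2 - C) := by
      gcongr
      linarith
    rw [mul_one_div_cancel hT.ne'] at h3
    linarith
  rw [Real.rpow_def_of_pos (by positivity)]
  calc _ ≤ Real.exp ((∫ τ in (0:ℝ)..T, f₁₁ τ) + -1) := Real.exp_le_exp.2 hfin
    _ = Real.exp (∫ τ in (0:ℝ)..T, f₁₁ τ) * Real.exp (-1) := Real.exp_add _ _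
    _ ≤ _ := by gcongr
end

section
/- Let T > 0 and C ≥ 1. There exists ε₂⁰ ∈ (0,1), depending only on T and C, with the following property. Let ε₂ ∈ (0, ε₂⁰), ε₁ ∈ (0, ε₂^{8 e^{2T}}), υ ∈ (0, ε₁^{10}), and let α, β satisfy ε₁ < α < β^{8 e^{2T}} and β < ε₂. Define the region ℵ = {(x,y) ∈ ℝ² : x > ε₁, √x < y < ε₂}. Let (x, y) : [0,T] → ℝ² be differentiable with x(0) = α, y(0) = β, and suppose that at every time t ∈ [0,T] at which (x(t), y(t)) ∈ ℵ the differential inequalities x(t)(−log y(t) − C) − υ y(t) ≤ x'(t) ≤ x(t)(−log y(t) + C) + υ y(t) and −y(t)(−log y(t) + C) ≤ y'(t) ≤ −y(t)(−log y(t) − C) hold. Then (x(t), y(t)) ∈ ℵ for all t ∈ [0,T]. -/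
open Real Set

lemma aux_arith (E L C M X A Y : ℝ) (hE : 1 ≤ E) (hC : 1 ≤ C) (hM : 0 < M)
    (hL : 4 * C + M + 1 < L) (hA : A < -(8 * (E * E) * L))
    (hX : X + Y - M ≤ A - L) (hY : -Y + C ≤ (L + C) * E) : X < 2 * Y := by
  have hLp : 0 < L := by linarith
  have q1 : (L + C) * E ≤ (5 / 4 * L) * E :=
    mul_le_mul_of_nonneg_right (by linarith) (by linarith)
  have q2 : L * E ≤ L * (E * E) := by
    apply mul_le_mul_of_nonneg_left _ hLp.le
    nlinarith
  have q3 : L * 1 ≤ L * E := mul_le_mul_of_nonneg_left hE hLp.le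
  linarith

lemma aux_le (s : ℝ) (hs : 0 ≤ s) (f f' : ℝ → ℝ) (hc : ContinuousOn f (Icc 0 s))
    (hd : ∀ t ∈ Ioo 0 s, HasDerivAt f (f' t) t) (hn : ∀ t ∈ Ioo 0 s, f' t ≤ 0) :
    f s ≤ f 0 := by
  have h := antitoneOn_of_deriv_nonpos (convex_Icc 0 s) hc
    (fun t ht => by
      rw [interior_Icc] at ht
      exact (hd t ht).differentiableAt.differentiableWithinAt)
    (fun t ht => by
      rw [interior_Icc] at ht
      rw [(hd t ht).deriv]; exact hn t ht)
  exact h (left_mem_Icc.2 hs) (right_mem_Icc.2 hs) hs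


/-- Trajectories of the model system starting in
`Ω₀ = {ε₁ < α < β^{8e^{2T}}, β < ε₂}` stay inside the hyperbolic region
`ℵ = {x > ε₁, √x < y < ε₂}` for the whole time interval `[0,T]`. -/
theorem trajectory_stays_in_region
    (T C : ℝ) (hT : 0 < T) (hC : 1 ≤ C) :
    ∃ ε₂max ∈ Ioo (0:ℝ) 1, ∀ ε₂ ε₁ υ α β : ℝ,
      ε₂ ∈ Ioo (0:ℝ) ε₂max →
      ε₁ ∈ Ioo (0:ℝ) (ε₂ ^ (8 * Real.exp (2 * T))) →
      υ ∈ Ioo (0:ℝ) (ε₁ ^ (10:ℕ)) →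
      0 < β → ε₁ < α → α < β ^ (8 * Real.exp (2 * T)) → β < ε₂ →
      ∀ x y dx dy : ℝ → ℝ,
        x 0 = α → y 0 = β →
        (∀ t ∈ Icc (0:ℝ) T, HasDerivWithinAt x (dx t) (Icc 0 T) t) →
        (∀ t ∈ Icc (0:ℝ) T, HasDerivWithinAt y (dy t) (Icc 0 T) t) →
        (∀ t ∈ Icc (0:ℝ) T,
          (ε₁ < x t ∧ Real.sqrt (x t) < y t ∧ y t < ε₂) →
            (x t * (-Real.log (y t) - C) - υ * y t ≤ dx t ∧
             dx t ≤ x t * (-Real.log (y t) + C) + υ * y t ∧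
             -(y t) * (-Real.log (y t) + C) ≤ dy t ∧
             dy t ≤ -(y t) * (-Real.log (y t) - C))) →
        ∀ t ∈ Icc (0:ℝ) T, ε₁ < x t ∧ Real.sqrt (x t) < y t ∧ y t < ε₂ := by
  refine ⟨Real.exp (-(4 * C + (2 * C + 1) * T + 1)), ⟨Real.exp_pos _, ?_⟩, ?_⟩
  · rw [Real.exp_lt_one_iff]; nlinarith
  intro ε₂ ε₁ υ α β hε₂ hε₁ hυ hβ hα1 hα2 hβ2 x y dx dy hx0 hy0 hdx hdy hode
  obtain ⟨hε₂0, hε₂1⟩ := hε₂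
  obtain ⟨hε₁0, hε₁1⟩ := hε₁
  obtain ⟨hυ0, hυ1⟩ := hυ
  have hα0 : 0 < α := hε₁0.trans hα1
  have hM : 0 < (2 * C + 1) * T := by positivity
  have hlogε : ∀ z, 0 < z → z < ε₂ → 4 * C + (2 * C + 1) * T + 1 < -Real.log z := by
    intro z hz hz2
    have := (Real.log_lt_iff_lt_exp hz).2 (hz2.trans hε₂1)
    linarith
  have hL0 := hlogε β hβ hβ2
  have hε₂lt : ε₂ < 1 := hε₂1.trans (by rw [Real.exp_lt_one_iff]; nlinarith)
  have hε₁lt : ε₁ < 1 :=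
    hε₁1.trans_le (Real.rpow_le_one hε₂0.le hε₂lt.le (by positivity))
  have hυε : υ < ε₁ := hυ1.trans_le (pow_le_of_le_one hε₁0.le hε₁lt.le (by norm_num))
  have hlogα : Real.log α < 8 * Real.exp (2 * T) * Real.log β := by
    have := Real.log_lt_log hα0 hα2
    rwa [Real.log_rpow hβ] at this
  have hE : Real.exp (2 * T) = Real.exp T * Real.exp T := by
    rw [← Real.exp_add]; ring_nf
  have hE1 : 1 ≤ Real.exp T := Real.one_le_exp hT.le
  have hcx : ContinuousOn x (Icc 0 T) := fun t ht => (hdx t ht).continuousWithinAt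
  have hcy : ContinuousOn y (Icc 0 T) := fun t ht => (hdy t ht).continuousWithinAt
  have hcsx : ContinuousOn (fun t => Real.sqrt (x t)) (Icc 0 T) := hcx.sqrt
  -- the main a priori estimate: if in the region on `[0,s)` then in the region at `s`
  have key : ∀ s ∈ Icc (0:ℝ) T,
      (∀ t ∈ Ico (0:ℝ) s, ε₁ < x t ∧ Real.sqrt (x t) < y t ∧ y t < ε₂) →
      ε₁ < x s ∧ Real.sqrt (x s) < y s ∧ y s < ε₂ := by
    intro s hs hgood
    have hsub : Icc 0 s ⊆ Icc 0 T := Icc_subset_Icc_right hs.2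
    have hD : ∀ t ∈ Ioo 0 s, HasDerivAt x (dx t) t ∧ HasDerivAt y (dy t) t := by
      intro t ht
      have hn : Icc 0 T ∈ nhds t := Icc_mem_nhds ht.1 (ht.2.trans_le hs.2)
      have ht' : t ∈ Icc 0 T := mem_of_mem_nhds hn
      exact ⟨(hdx t ht').hasDerivAt hn, (hdy t ht').hasDerivAt hn⟩
    have hcx' := hcx.mono hsub
    have hcy' := hcy.mono hsub
    -- pointwise facts
    have hpt : ∀ t ∈ Ioo 0 s, 0 < x t ∧ 0 < y t ∧ 0 ≤ dx t ∧ dy t ≤ 0 ∧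
        -(y t) * (-Real.log (y t) + C) ≤ dy t ∧
        dx t / x t + dy t / y t ≤ 2 * C + 1 := by
      intro t ht
      obtain ⟨g1, g2, g3⟩ := hgood t ⟨ht.1.le, ht.2⟩
      obtain ⟨o1, o2, o3, o4⟩ := hode t ⟨ht.1.le, ht.2.le.trans hs.2⟩ ⟨g1, g2, g3⟩
      have hx : 0 < x t := hε₁0.trans g1
      have hy : 0 < y t := (Real.sqrt_nonneg _).trans_lt g2
      have hl := hlogε (y t) hy g3
      have hvy : υ * y t ≤ x t := by nlinarith
      refine ⟨hx, hy, ?_, ?_, o3, ?_⟩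
      · nlinarith
      · nlinarith
      · have a1 : dx t / x t ≤ -Real.log (y t) + C + 1 := by
          rw [div_le_iff₀ hx]; linarith
        have a2 : dy t / y t ≤ -(-Real.log (y t) - C) := by
          rw [div_le_iff₀ hy]; linarith
        linarith
    have hxs : α ≤ x s := by
      have := aux_le s hs.1 (fun t => - x t) (fun t => - dx t) hcx'.neg
        (fun t ht => (hD t ht).1.neg) (fun t ht => by linarith [(hpt t ht).2.2.1])
      simp only [hx0] at this
      linarith
    have hys : y s ≤ β := by
      have := aux_le s hs.1 y dy hcy'
        (fun t ht => (hD t ht).2) (fun t ht => (hpt t ht).2.2.2.1)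
      rwa [hy0] at this
    have hsq : Real.sqrt (x s) ≤ y s := by
      rcases hs.1.eq_or_lt with h0 | h0
      · subst h0
        rw [hx0, hy0]
        apply Real.sqrt_le_iff.2 ⟨hβ.le, ?_⟩
        rw [← Real.log_le_log_iff hα0 (by positivity), Real.log_pow]
        push_cast
        have e1 : 1 ≤ Real.exp (2 * T) := Real.one_le_exp (by linarith)
        have e2 : 0 ≤ (Real.exp (2 * T) - 1) * (-Real.log β) :=
          mul_nonneg (by linarith) (by linarith)
        linarith
      · have hcl : s ∈ closure (Ico 0 s) := by
          rw [closure_Ico h0.ne]; exact ⟨h0.le, le_rfl⟩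
        have hsI : Icc 0 s ⊆ Icc 0 T := hsub
        refine ContinuousWithinAt.closure_le hcl
          ((hcsx s hs).mono (Ico_subset_Icc_self.trans hsI))
          ((hcy s hs).mono (Ico_subset_Icc_self.trans hsI)) ?_
        intro t ht
        exact (hgood t ht).2.1.le
    have hxs0 : 0 < x s := hα0.trans_le hxs
    have hys0 : 0 < y s := (Real.sqrt_pos.2 hxs0).trans_le hsq
    have hpos : ∀ t ∈ Icc 0 s, x t ≠ 0 ∧ y t ≠ 0 := by
      intro t ht
      rcases ht.2.eq_or_lt with h | h
      · subst h; exact ⟨hxs0.ne', hys0.ne'⟩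
      · obtain ⟨g1, g2, -⟩ := hgood t ⟨ht.1, h⟩
        exact ⟨(hε₁0.trans g1).ne', ((Real.sqrt_nonneg _).trans_lt g2).ne'⟩
    have hly : ContinuousOn (fun t => Real.log (y t)) (Icc 0 s) :=
      hcy'.log fun t ht => (hpos t ht).2
    have hlx : ContinuousOn (fun t => Real.log (x t)) (Icc 0 s) :=
      hcx'.log fun t ht => (hpos t ht).1
    have h3 : (-Real.log (y s) + C) * Real.exp (-s) ≤ -Real.log β + C := by
      have := aux_le s hs.1 (fun t => (-Real.log (y t) + C) * Real.exp (-t))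
        (fun t => (-(dy t / y t)) * Real.exp (-t)
          + (-Real.log (y t) + C) * (Real.exp (-t) * (-1)))
        ((hly.neg.add continuousOn_const).mul (by fun_prop))
        (fun t ht => by
          have h1 := (((hD t ht).2.log (hpt t ht).2.1.ne').neg.add_const C)
          exact h1.mul (hasDerivAt_neg t).exp)
        (fun t ht => by
          obtain ⟨p1, p2, p3, p4, p5, p6⟩ := hpt t ht
          have : -(dy t / y t) ≤ -Real.log (y t) + C := by
            rw [← neg_div, div_le_iff₀ p2]; linarith
          have he := Real.exp_pos (-t)
          nlinarith)
      simpa [hy0] using this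
    have h4 : Real.log (x s) + Real.log (y s) - (2 * C + 1) * s
        ≤ Real.log α + Real.log β := by
      have := aux_le s hs.1 (fun t => Real.log (x t) + Real.log (y t) - (2 * C + 1) * t)
        (fun t => dx t / x t + dy t / y t - (2 * C + 1) * 1)
        ((hlx.add hly).sub (by fun_prop))
        (fun t ht => (((hD t ht).1.log (hpt t ht).1.ne').add
          ((hD t ht).2.log (hpt t ht).2.1.ne')).sub ((hasDerivAt_id t).const_mul _))
        (fun t ht => by linarith [(hpt t ht).2.2.2.2.2])
      simpa [hx0, hy0] using this
    refine ⟨hα1.trans_le hxs, ?_, hys.trans_lt hβ2⟩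
    have h5 : -Real.log (y s) + C ≤ (-Real.log β + C) * Real.exp T := by
      have e1 : Real.exp (-s) * Real.exp s = 1 := by rw [← Real.exp_add]; simp
      have e2 : Real.exp s ≤ Real.exp T := Real.exp_le_exp.2 hs.2
      calc -Real.log (y s) + C = (-Real.log (y s) + C) * Real.exp (-s) * Real.exp s := by
            rw [mul_assoc, e1, mul_one]
        _ ≤ (-Real.log β + C) * Real.exp s :=
            mul_le_mul_of_nonneg_right h3 (Real.exp_pos s).le
        _ ≤ _ := mul_le_mul_of_nonneg_left e2 (by linarith)
    have h6 : (2 * C + 1) * s ≤ (2 * C + 1) * T :=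
      mul_le_mul_of_nonneg_left hs.2 (by linarith)
    rw [hE] at hlogα
    have h7 : Real.log (x s) < 2 * Real.log (y s) := by
      exact aux_arith (Real.exp T) (-Real.log β) C ((2 * C + 1) * T) _ (Real.log α) _
        hE1 hC hM hL0 (by linarith) (by linarith) h5
    apply (Real.sqrt_lt' hys0).2
    rw [← Real.log_lt_log_iff hxs0 (by positivity), Real.log_pow]
    push_cast
    exact h7
  by_contra hcon
  push Not at hcon
  -- first exit time
  let B : Set ℝ := {t | t ∈ Icc (0:ℝ) T ∧
    ¬ (ε₁ < x t ∧ Real.sqrt (x t) < y t ∧ y t < ε₂)}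
  have hBne : B.Nonempty := by
    obtain ⟨t, ht, h⟩ := hcon
    exact ⟨t, ht, fun h' => absurd h'.2.2 (not_lt.2 (h h'.1 h'.2.1))⟩
  have hBc : IsClosed B := by
    have hB : B = (Icc 0 T ∩ x ⁻¹' Iic ε₁) ∪
        ((Icc 0 T ∩ (fun t => y t - Real.sqrt (x t)) ⁻¹' Iic 0) ∪
          (Icc 0 T ∩ y ⁻¹' Ici ε₂)) := by
      ext t
      simp only [B, mem_setOf_eq, mem_union, mem_inter_iff, mem_preimage, mem_Iic, mem_Ici,
        not_and_or, not_lt, sub_nonpos]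
      tauto
    rw [hB]
    exact (hcx.preimage_isClosed_of_isClosed isClosed_Icc isClosed_Iic).union
      (((hcy.sub hcsx).preimage_isClosed_of_isClosed isClosed_Icc isClosed_Iic).union
        (hcy.preimage_isClosed_of_isClosed isClosed_Icc isClosed_Ici))
  have hBb : BddBelow B := ⟨0, fun t ht => ht.1.1⟩
  have hs := hBc.csInf_mem hBne hBb
  refine hs.2 (key _ hs.1 fun t ht => ?_)
  by_contra hbad
  exact absurd (csInf_le hBb (show t ∈ B from ⟨⟨ht.1, ht.2.le.trans hs.1.2⟩, hbad⟩))
    (not_le.2 ht.2)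
end

section
/- Let Φ : ℝ² → ℝ² be a bijection such that Φ and Φ^{-1} are Lebesgue measurable and Φ preserves Lebesgue measure (the measure of Φ(S) equals the measure of S for every measurable S). Let B ⊂ ℝ² be a closed ball of radius γ > 0, let a < b, let Γ : [a,b] → ℝ be continuous, and let d > 0. Suppose every point z ∈ ℝ² with ‖z − (x, Γ(x))‖ < d for some x ∈ [a,b] belongs to Φ(B). Then 2d·(b − a) ≤ π γ². -/
open Real Set MeasureTheory

/-- Area-preservation argument: if the image of a closed Euclidean disk of radius `γ`
under a measure-preserving bijection of `ℝ²` contains the open `d`-neighborhood of the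
graph of a continuous function `Γ : [a,b] → ℝ`, then `2d(b−a) ≤ πγ²`. -/
theorem area_preserving_image_of_disk
    (Φ : (ℝ × ℝ) ≃ (ℝ × ℝ)) (hΦ : Measurable Φ) (hΦinv : Measurable Φ.symm)
    (hpres : ∀ S : Set (ℝ × ℝ), MeasurableSet S → volume (Φ '' S) = volume S)
    (γ : ℝ) (hγ : 0 < γ) (c : ℝ × ℝ)
    (a b : ℝ) (hab : a < b) (Γ : ℝ → ℝ) (hΓ : ContinuousOn Γ (Icc a b))
    (d : ℝ) (hd : 0 < d)
    (hsub : ∀ z : ℝ × ℝ,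
      (∃ x ∈ Icc a b, Real.sqrt ((z.1 - x) ^ 2 + (z.2 - Γ x) ^ 2) < d) →
      z ∈ Φ '' {p : ℝ × ℝ | Real.sqrt ((p.1 - c.1) ^ 2 + (p.2 - c.2) ^ 2) ≤ γ}) :
    2 * d * (b - a) ≤ π * γ ^ 2 := by
  set D : Set (ℝ × ℝ) := {p : ℝ × ℝ | Real.sqrt ((p.1 - c.1) ^ 2 + (p.2 - c.2) ^ 2) ≤ γ} with hD
  have hDm : MeasurableSet D := by
    apply measurableSet_le <;> fun_prop
  have hvD : volume D = ENNReal.ofReal (π * γ ^ 2) := by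
    rw [← Complex.volume_preserving_equiv_real_prod.measure_preimage hDm.nullMeasurableSet]
    have : Complex.measurableEquivRealProd ⁻¹' D = Metric.closedBall (⟨c.1, c.2⟩ : ℂ) γ := by
      ext z
      simp [hD, Complex.dist_eq_re_im]
    rw [this, Complex.volume_closedBall, mul_comm, ENNReal.ofReal_mul Real.pi_pos.le,
      ENNReal.ofReal_pow hγ.le]
    congr 1
    rw [ENNReal.ofReal, Real.toNNReal_of_nonneg Real.pi_pos.le]
    rfl
  have hi : IntegrableOn Γ (Icc a b) := hΓ.integrableOn_Icc
  have hc : IntegrableOn (fun _ : ℝ => d) (Icc a b) := continuousOn_const.integrableOn_Icc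
  have hR : volume (regionBetween (fun x => Γ x - d) (fun x => Γ x + d) (Icc a b))
      = ENNReal.ofReal (2 * d * (b - a)) := by
    rw [Measure.volume_eq_prod, volume_regionBetween_eq_integral (f := fun x => Γ x - d)
      (g := fun x => Γ x + d) (hi.sub hc) (hi.add hc)
      measurableSet_Icc (fun x _ => by linarith)]
    congr 1
    have : ∀ x, ((fun x => Γ x + d) - fun x => Γ x - d) x = 2 * d := by
      intro x
      simp only [Pi.sub_apply]
      ring
    simp only [this]
    simp [hab.le]
    ring
  have hle : volume (regionBetween (fun x => Γ x - d) (fun x => Γ x + d) (Icc a b))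
      ≤ volume (Φ '' D) := by
    apply measure_mono
    rintro ⟨x, y⟩ ⟨hx, hy1, hy2⟩
    refine hsub _ ⟨x, hx, ?_⟩
    simp only at hy1 hy2 ⊢
    rw [sub_self, zero_pow two_ne_zero, zero_add, Real.sqrt_sq_eq_abs, abs_lt]
    constructor <;> linarith
  rw [hR, hpres D hDm, hvD] at hle
  exact (ENNReal.ofReal_le_ofReal_iff (by positivity)).1 hle
end

section
/- There is an absolute constant C > 0 with the following property. Let τ ∈ (0, 1/2), let A = {ξ ∈ ℝ² : ‖ξ‖ ≤ 4 and (|ξ₁| ≤ τ or |ξ₂| ≤ τ)}, let p : ℝ² → ℝ be measurable with |p(ξ)| ≤ 2 for all ξ, and let z ∈ ℝ² and δ > 0 be such that ‖ξ − z‖ ≥ δ for all ξ ∈ A. Then ‖ ∫_A ( (ξ − z)/‖ξ − z‖² − ξ/‖ξ‖² ) p(ξ) dξ ‖ ≤ C · ‖z‖ · τ(1 + log(1/τ)) / δ. -/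
open Real Set MeasureTheory

/-- weight `|t|^{-1/2}` on `|t| ≤ τ` -/
noncomputable def wA (τ t : ℝ) : ℝ := (Iic τ).indicator (fun s => s ^ (-(1/2) : ℝ)) |t|
/-- indicator of `|t| ≤ τ` -/
noncomputable def wU (τ t : ℝ) : ℝ := (Iic τ).indicator (fun _ => (1:ℝ)) |t|
/-- weight `1/|t|` on `τ < |t| ≤ 4` -/
noncomputable def wB (τ t : ℝ) : ℝ := (Ioc τ 4).indicator (fun s => s⁻¹) |t|

lemma wA_nonneg (τ t : ℝ) : 0 ≤ wA τ t :=
  Set.indicator_apply_nonneg fun _ => Real.rpow_nonneg (abs_nonneg t) _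
lemma wU_nonneg (τ t : ℝ) : 0 ≤ wU τ t :=
  Set.indicator_apply_nonneg fun _ => zero_le_one
lemma wB_nonneg (τ t : ℝ) : 0 ≤ wB τ t :=
  Set.indicator_apply_nonneg fun _ => inv_nonneg.2 (abs_nonneg t)

lemma wA_integral {τ : ℝ} (h : 0 < τ) : ∫ t, wA τ t = 4 * τ ^ ((1/2) : ℝ) := by
  unfold wA
  rw [integral_comp_abs (f := (Iic τ).indicator (fun s => s ^ (-(1/2) : ℝ))),
    setIntegral_indicator measurableSet_Iic, Ioi_inter_Iic,
    ← intervalIntegral.integral_of_le h.le, integral_rpow (Or.inl (by norm_num))]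
  norm_num
  ring

lemma wU_integral {τ : ℝ} (h : 0 < τ) : ∫ t, wU τ t = 2 * τ := by
  unfold wU
  rw [integral_comp_abs (f := (Iic τ).indicator (fun _ => (1:ℝ))),
    setIntegral_indicator measurableSet_Iic, Ioi_inter_Iic,
    ← intervalIntegral.integral_of_le h.le]
  simp

lemma wB_integral {τ : ℝ} (h : 0 < τ) (h4 : τ < 4) : ∫ t, wB τ t = 2 * Real.log (4 / τ) := by
  unfold wB
  have hI : Ioi (0:ℝ) ∩ Ioc τ 4 = Ioc τ 4 :=
    inter_eq_right.2 fun x hx => h.trans hx.1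
  rw [integral_comp_abs (f := (Ioc τ 4).indicator (fun s => s⁻¹)),
    setIntegral_indicator measurableSet_Ioc, hI,
    ← intervalIntegral.integral_of_le h4.le, integral_inv_of_pos h (by norm_num)]

lemma integrable_of_integral_pos {f : ℝ → ℝ} (h : 0 < ∫ t, f t) : Integrable f := by
  by_contra hf
  rw [integral_undef hf] at h
  exact lt_irrefl _ h

lemma kernel_norm (x z : EuclideanSpace ℝ (Fin 2)) (hx : x ≠ 0) (hz : x - z ≠ 0) :
    ‖(‖x - z‖ ^ 2)⁻¹ • (x - z) - (‖x‖ ^ 2)⁻¹ • x‖ = ‖z‖ * (‖x - z‖)⁻¹ * (‖x‖)⁻¹ := by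
  have := dist_div_norm_sq_smul hz hx 1
  simp only [dist_eq_norm, one_div, inv_pow, one_pow, mul_inv] at this
  rw [this]
  have h2 : x - z - x = -z := by abel
  rw [h2, norm_neg]
  ring

/-- the dominating function -/
noncomputable def wF (τ : ℝ) (q : ℝ × ℝ) : ℝ :=
  wA τ q.1 * wA τ q.2 + (wU τ q.1 * wB τ q.2 + wB τ q.1 * wU τ q.2)

lemma wF_nonneg (τ : ℝ) (q : ℝ × ℝ) : 0 ≤ wF τ q := by
  have := wA_nonneg τ q.1
  have := wA_nonneg τ q.2
  have := wB_nonneg τ q.1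
  have := wB_nonneg τ q.2
  have := wU_nonneg τ q.1
  have := wU_nonneg τ q.2
  unfold wF
  positivity

lemma wF_integral {τ : ℝ} (h : 0 < τ) (h4 : τ < 4) :
    Integrable (wF τ) ∧ ∫ q, wF τ q = 16 * τ + 8 * τ * Real.log (4 / τ) := by
  have hA : Integrable (wA τ) := integrable_of_integral_pos (by
    rw [wA_integral h]; positivity)
  have hU : Integrable (wU τ) := integrable_of_integral_pos (by
    rw [wU_integral h]; positivity)
  have hB : Integrable (wB τ) := integrable_of_integral_pos (by
    rw [wB_integral h h4]
    have : 0 < Real.log (4 / τ) := Real.log_pos (by rw [lt_div_iff₀ h]; linarith)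
    positivity)
  have h1 : Integrable (fun q : ℝ × ℝ => wA τ q.1 * wA τ q.2) := hA.mul_prod hA
  have h2 : Integrable (fun q : ℝ × ℝ => wU τ q.1 * wB τ q.2) := hU.mul_prod hB
  have h3 : Integrable (fun q : ℝ × ℝ => wB τ q.1 * wU τ q.2) := hB.mul_prod hU
  have h23 : Integrable (fun q : ℝ × ℝ => wU τ q.1 * wB τ q.2 + wB τ q.1 * wU τ q.2) := h2.add h3
  refine ⟨h1.add h23, ?_⟩
  unfold wF
  rw [integral_add h1 h23, integral_add h2 h3, Measure.volume_eq_prod, integral_prod_mul,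
    integral_prod_mul, integral_prod_mul, wA_integral h, wU_integral h, wB_integral h h4]
  have : τ ^ ((1/2):ℝ) * τ ^ ((1/2):ℝ) = τ := by
    rw [← Real.rpow_add h]; norm_num
  linear_combination 16 * this

lemma inv_norm_le {τ x y n : ℝ} (hx : x ≠ 0) (hy : y ≠ 0) (hn : 0 < n)
    (hnn : n ^ 2 = x ^ 2 + y ^ 2) (hn4 : n ≤ 4) (hA : |x| ≤ τ ∨ |y| ≤ τ) :
    n⁻¹ ≤ wF τ (x, y) := by
  have a1 := wA_nonneg τ x
  have a2 := wA_nonneg τ y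
  have a3 := wB_nonneg τ x
  have a4 := wB_nonneg τ y
  have a5 := wU_nonneg τ x
  have a6 := wU_nonneg τ y
  have hx' := abs_pos.2 hx
  have hy' := abs_pos.2 hy
  have hxn : |x| ≤ n := abs_le_of_sq_le_sq (by nlinarith) hn.le
  have hyn : |y| ≤ n := abs_le_of_sq_le_sq (by nlinarith) hn.le
  have e1 := mul_nonneg a1 a2
  have e2 := mul_nonneg a5 a4
  have e3 := mul_nonneg a3 a6
  unfold wF
  by_cases h1 : |x| ≤ τ <;> by_cases h2 : |y| ≤ τ
  · have : n⁻¹ ≤ wA τ x * wA τ y := by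
      unfold wA
      rw [indicator_of_mem (by exact h1), indicator_of_mem (by exact h2),
        ← Real.mul_rpow hx'.le hy'.le]
      have hn2 : n⁻¹ = (n ^ 2) ^ (-(1/2) : ℝ) := by
        rw [← Real.rpow_natCast, ← Real.rpow_mul hn.le]
        norm_num [Real.rpow_neg_one]
      rw [hn2]
      refine Real.rpow_le_rpow_of_nonpos (by positivity) ?_ (by norm_num)
      nlinarith
    simp only
    linarith
  · have : n⁻¹ ≤ wU τ x * wB τ y := by
      unfold wU wB
      rw [indicator_of_mem (by exact h1), indicator_of_mem (by
        exact ⟨not_le.1 h2, hyn.trans hn4⟩), one_mul]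
      exact inv_anti₀ hy' hyn
    simp only
    linarith
  · have : n⁻¹ ≤ wB τ x * wU τ y := by
      unfold wU wB
      rw [indicator_of_mem (by exact ⟨not_le.1 h1, hxn.trans hn4⟩),
        indicator_of_mem (by exact h2), mul_one]
      exact inv_anti₀ hx' hxn
    simp only
    linarith
  · exact absurd hA (by tauto)

/-- coordinates -/
noncomputable def coordE : EuclideanSpace ℝ (Fin 2) ≃ᵐ ℝ × ℝ :=
  (MeasurableEquiv.toLp 2 (Fin 2 → ℝ)).symm.trans MeasurableEquiv.finTwoArrow

lemma coordE_apply (x : EuclideanSpace ℝ (Fin 2)) : coordE x = (x 0, x 1) := rfl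

lemma coordE_mp : MeasurePreserving coordE :=
  (volume_preserving_finTwoArrow ℝ).comp (PiLp.volume_preserving_ofLp (Fin 2))

/-- Estimate on the velocity-field perturbation produced by modifying the singular
cross steady state inside a cross of width `τ`: for `z` at distance at least `δ`
from the cross `A`,
`‖∫_A ((ξ−z)/‖ξ−z‖² − ξ/‖ξ‖²) p(ξ) dξ‖ ≤ C ‖z‖ τ(1 + log(1/τ))/δ`. -/
theorem cross_perturbation_velocity_estimate :
    ∃ C : ℝ, 0 < C ∧
      ∀ (τ : ℝ), τ ∈ Ioo (0:ℝ) (1/2) →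
      ∀ (p : EuclideanSpace ℝ (Fin 2) → ℝ), Measurable p →
        (∀ ξ : EuclideanSpace ℝ (Fin 2), |p ξ| ≤ 2) →
      ∀ (z : EuclideanSpace ℝ (Fin 2)) (δ : ℝ), 0 < δ →
        (∀ ξ ∈ {ξ : EuclideanSpace ℝ (Fin 2) | ‖ξ‖ ≤ 4 ∧ (|ξ 0| ≤ τ ∨ |ξ 1| ≤ τ)},
          δ ≤ ‖ξ - z‖) →
        ‖∫ ξ in {ξ : EuclideanSpace ℝ (Fin 2) | ‖ξ‖ ≤ 4 ∧ (|ξ 0| ≤ τ ∨ |ξ 1| ≤ τ)},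
            p ξ • ((‖ξ - z‖ ^ 2)⁻¹ • (ξ - z) - (‖ξ‖ ^ 2)⁻¹ • ξ)‖ ≤
          C * ‖z‖ * τ * (1 + Real.log (1 / τ)) / δ := by
  refine ⟨64, by norm_num, ?_⟩
  rintro τ ⟨h0, h12⟩ p - hp z δ hδ hz
  set A := {ξ : EuclideanSpace ℝ (Fin 2) | ‖ξ‖ ≤ 4 ∧ (|ξ 0| ≤ τ ∨ |ξ 1| ≤ τ)} with hAdef
  obtain ⟨hFi, hFv⟩ := wF_integral h0 (by linarith)
  set c := 2 * ‖z‖ / δ with hc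
  have hc0 : 0 ≤ c := by positivity
  have hAm : MeasurableSet A := by
    have : IsClosed A := by
      apply IsClosed.inter
      · exact isClosed_le continuous_norm continuous_const
      · apply IsClosed.union
        · exact isClosed_le (f := fun ξ : EuclideanSpace ℝ (Fin 2) => |ξ 0|) (by fun_prop)
            continuous_const
        · exact isClosed_le (f := fun ξ : EuclideanSpace ℝ (Fin 2) => |ξ 1|) (by fun_prop)
            continuous_const
    exact this.measurableSet
  have hGi : Integrable (fun ξ : EuclideanSpace ℝ (Fin 2) => c * wF τ (coordE ξ)) :=
    (coordE_mp.integrable_comp_of_integrable hFi).const_mul c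
  have hGv : ∫ ξ : EuclideanSpace ℝ (Fin 2), c * wF τ (coordE ξ)
      = c * (16 * τ + 8 * τ * Real.log (4 / τ)) := by
    rw [integral_const_mul, coordE_mp.integral_comp' (g := wF τ), hFv]
  have hne : ∀ᵐ ξ : EuclideanSpace ℝ (Fin 2), (coordE ξ).1 ≠ 0 ∧ (coordE ξ).2 ≠ 0 := by
    refine coordE_mp.quasiMeasurePreserving.ae (p := fun q => q.1 ≠ 0 ∧ q.2 ≠ 0) ?_
    have h : ∀ᵐ t : ℝ, t ≠ 0 := Measure.ae_ne volume 0
    rw [Measure.volume_eq_prod]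
    exact (Measure.quasiMeasurePreserving_fst.ae h).and (Measure.quasiMeasurePreserving_snd.ae h)
  have key : ∀ᵐ ξ ∂(volume.restrict A),
      ‖p ξ • ((‖ξ - z‖ ^ 2)⁻¹ • (ξ - z) - (‖ξ‖ ^ 2)⁻¹ • ξ)‖ ≤ c * wF τ (coordE ξ) := by
    rw [ae_restrict_iff' hAm]
    filter_upwards [hne] with ξ hξ hA
    rw [coordE_apply] at hξ ⊢
    have hξ0 : ξ ≠ 0 := by
      rintro rfl
      exact hξ.1 rfl
    have hd := hz ξ hA
    have hsub : ξ - z ≠ 0 := norm_pos_iff.1 (hδ.trans_le hd)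
    have hnpos := norm_pos_iff.2 hξ0
    have hnn : ‖ξ‖ ^ 2 = ξ 0 ^ 2 + ξ 1 ^ 2 := by
      rw [EuclideanSpace.real_norm_sq_eq, Fin.sum_univ_two]
    have hF := inv_norm_le hξ.1 hξ.2 hnpos hnn hA.1 hA.2
    have hinv : ‖ξ - z‖⁻¹ ≤ δ⁻¹ := inv_anti₀ hδ hd
    rw [norm_smul, kernel_norm ξ z hξ0 hsub, Real.norm_eq_abs]
    calc |p ξ| * (‖z‖ * ‖ξ - z‖⁻¹ * ‖ξ‖⁻¹)
        ≤ 2 * (‖z‖ * δ⁻¹ * wF τ (ξ 0, ξ 1)) := by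
          gcongr
          exact hp ξ
      _ = c * wF τ (ξ 0, ξ 1) := by rw [hc]; ring
  calc _ ≤ ∫ ξ in A, c * wF τ (coordE ξ) := norm_integral_le_of_norm_le hGi.integrableOn key
    _ ≤ ∫ ξ, c * wF τ (coordE ξ) := setIntegral_le_integral hGi
        (Filter.Eventually.of_forall fun ξ => mul_nonneg hc0 (wF_nonneg _ _))
    _ = c * (16 * τ + 8 * τ * Real.log (4 / τ)) := hGv
    _ ≤ c * (32 * τ * (1 + Real.log (1 / τ))) := by
        apply mul_le_mul_of_nonneg_left _ hc0
        have e : Real.log (4 / τ) = Real.log 4 + Real.log (1 / τ) := by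
          rw [← Real.log_mul (by norm_num) (by positivity)]
          congr 1
          ring
        have hl4 : Real.log 4 ≤ 2 := by
          have : (4:ℝ) = 2 ^ 2 := by norm_num
          rw [this, Real.log_pow]
          have := Real.log_two_lt_d9
          push_cast
          linarith
        have hl : 0 ≤ Real.log (1 / τ) := Real.log_nonneg (by rw [le_div_iff₀ h0]; linarith)
        rw [e]
        nlinarith [mul_nonneg h0.le hl, mul_le_mul_of_nonneg_left hl4 h0.le]
    _ = 64 * ‖z‖ * τ * (1 + Real.log (1 / τ)) / δ := by rw [hc]; ring
end

section
/- There is an absolute constant C > 0 with the following property. Let b : ℝ² → ℝ be differentiable with ‖∇b(ξ)‖ ≤ M for all ξ ∈ ℝ², let z ∈ ℝ², and let 0 < ρ' < ρ. Then | ∫_{ρ' < ‖ξ − z‖ < ρ} ( (ξ₁ − z₁)(ξ₂ − z₂) / ‖ξ − z‖⁴ ) b(ξ) dξ | ≤ C M ρ. -/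
open Real Set MeasureTheory

theorem aux_meas (z : EuclideanSpace ℝ (Fin 2)) (r R : ℝ) :
    MeasurableSet {ξ : EuclideanSpace ℝ (Fin 2) | r < ‖ξ - z‖ ∧ ‖ξ - z‖ < R} := by
  have h : Measurable (fun ξ : EuclideanSpace ℝ (Fin 2) => ‖ξ - z‖) := by fun_prop
  exact h measurableSet_Ioo

theorem aux_zero (z : EuclideanSpace ℝ (Fin 2)) (r R : ℝ) :
    ∫ ξ in {ξ : EuclideanSpace ℝ (Fin 2) | r < ‖ξ - z‖ ∧ ‖ξ - z‖ < R},
      ((ξ 0 - z 0) * (ξ 1 - z 1) / ‖ξ - z‖ ^ 4) = 0 := by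
  have hm : MeasurableSet {ξ : EuclideanSpace ℝ (Fin 2) | r < ‖ξ - z‖ ∧ ‖ξ - z‖ < R} :=
    aux_meas z r R
  rw [← integral_indicator hm]
  let F : EuclideanSpace ℝ (Fin 2) → ℝ := {x : EuclideanSpace ℝ (Fin 2) | r < ‖x‖ ∧ ‖x‖ < R}.indicator (fun x => x 0 * x 1 / ‖x‖ ^ 4)
  have h1 : (fun ξ : EuclideanSpace ℝ (Fin 2) => {ξ : EuclideanSpace ℝ (Fin 2) | r < ‖ξ - z‖ ∧ ‖ξ - z‖ < R}.indicator
      (fun ξ => ((ξ 0 - z 0) * (ξ 1 - z 1) / ‖ξ - z‖ ^ 4)) ξ) = fun ξ => F (ξ - z) := by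
    funext ξ
    simp [F, Set.indicator]
  rw [h1, integral_sub_right_eq_self F z]
  let e : EuclideanSpace ℝ (Fin 2) ≃ₗᵢ[ℝ] EuclideanSpace ℝ (Fin 2) := LinearIsometryEquiv.piLpCongrRight 2
    (fun i : Fin 2 => if i = 0 then LinearIsometryEquiv.neg ℝ else LinearIsometryEquiv.refl ℝ ℝ)
  have h2 : ∫ x, F (e x) = ∫ x, F x :=
    e.measurePreserving.integral_comp e.toHomeomorph.measurableEmbedding F
  have h3 : ∀ x, F (e x) = - F x := by
    intro x
    have e0 : e x 0 = - x 0 := by simp [e]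
    have e1 : e x 1 = x 1 := by simp [e]
    simp only [F, Set.indicator, mem_ofPred_eq, e.norm_map, e0, e1]
    split_ifs <;> ring
  simp only [h3, integral_neg] at h2
  linarith

theorem aux_inv (z : EuclideanSpace ℝ (Fin 2)) (r R : ℝ) (hr : 0 < r) (hR : r < R) :
    ∫ ξ in {ξ : EuclideanSpace ℝ (Fin 2) | r < ‖ξ - z‖ ∧ ‖ξ - z‖ < R}, ‖ξ - z‖⁻¹
      = 2 * (volume.real (Metric.ball (0 : EuclideanSpace ℝ (Fin 2)) 1) * (R - r)) := by
  have hm : MeasurableSet {ξ : EuclideanSpace ℝ (Fin 2) | r < ‖ξ - z‖ ∧ ‖ξ - z‖ < R} :=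
    aux_meas z r R
  rw [← integral_indicator hm]
  let g : ℝ → ℝ := (Ioo r R).indicator (fun t => t⁻¹)
  have h1 : (fun ξ : EuclideanSpace ℝ (Fin 2) => {ξ : EuclideanSpace ℝ (Fin 2) | r < ‖ξ - z‖ ∧ ‖ξ - z‖ < R}.indicator
      (fun ξ => ‖ξ - z‖⁻¹) ξ) = fun ξ => (fun x : EuclideanSpace ℝ (Fin 2) => g ‖x‖) (ξ - z) := by
    funext ξ
    simp [g, Set.indicator]
  rw [h1, integral_sub_right_eq_self (fun x : EuclideanSpace ℝ (Fin 2) => g ‖x‖) z, integral_fun_norm_addHaar]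
  have h2 : ∫ y in Ioi (0:ℝ), y ^ (Module.finrank ℝ (EuclideanSpace ℝ (Fin 2)) - 1) • g y = R - r := by
    have : ∀ y : ℝ, y ^ (Module.finrank ℝ (EuclideanSpace ℝ (Fin 2)) - 1) • g y = (Ioo r R).indicator (fun _ => (1:ℝ)) y := by
      intro y
      simp only [g, Set.indicator, finrank_euclideanSpace, Fintype.card_fin]
      split_ifs with h
      · have : y ≠ 0 := (hr.trans h.1).ne'
        simp [this]
      · simp
    simp only [this]
    rw [setIntegral_indicator measurableSet_Ioo,
      inter_eq_right.2 (fun y (hy : y ∈ Ioo r R) => mem_Ioi.2 (hr.trans hy.1))]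
    simp [hR.le]
  rw [h2]
  simp

theorem hessian_inner_estimate :
    ∃ C : ℝ, 0 < C ∧
      ∀ (b : EuclideanSpace ℝ (Fin 2) → ℝ) (M : ℝ), Differentiable ℝ b →
        (∀ ξ : EuclideanSpace ℝ (Fin 2), ‖fderiv ℝ b ξ‖ ≤ M) →
      ∀ (z : EuclideanSpace ℝ (Fin 2)) (ρ' ρ : ℝ), 0 < ρ' → ρ' < ρ →
        |∫ ξ in {ξ : EuclideanSpace ℝ (Fin 2) | ρ' < ‖ξ - z‖ ∧ ‖ξ - z‖ < ρ},
            ((ξ 0 - z 0) * (ξ 1 - z 1) / ‖ξ - z‖ ^ 4) * b ξ| ≤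
          C * M * ρ := by
  have hV : 0 < volume.real (Metric.ball (0 : EuclideanSpace ℝ (Fin 2)) 1) :=
    ENNReal.toReal_pos (Metric.measure_ball_pos _ _ one_pos).ne' measure_ball_lt_top.ne
  refine ⟨2 * volume.real (Metric.ball (0 : EuclideanSpace ℝ (Fin 2)) 1), by positivity, ?_⟩
  intro b M hb hM z r R hr hR
  have hM0 : 0 ≤ M := (norm_nonneg _).trans (hM z)
  have hbc : Continuous b := hb.continuous
  have hm : MeasurableSet {ξ : EuclideanSpace ℝ (Fin 2) | r < ‖ξ - z‖ ∧ ‖ξ - z‖ < R} :=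
    aux_meas z r R
  set A := {ξ : EuclideanSpace ℝ (Fin 2) | r < ‖ξ - z‖ ∧ ‖ξ - z‖ < R} with hA
  let K : Set (EuclideanSpace ℝ (Fin 2)) := Metric.closedBall z R ∩ {ξ | r ≤ ‖ξ - z‖}
  have hK : IsCompact K := (isCompact_closedBall z R).inter_right
    (isClosed_le (by fun_prop) (by fun_prop))
  have hAK : A ⊆ K := fun ξ h => ⟨by simpa [dist_eq_norm] using h.2.le, h.1.le⟩
  have hne : ∀ ξ ∈ K, ‖ξ - z‖ ≠ 0 := fun ξ h => (hr.trans_le h.2).ne'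
  have hkc : ContinuousOn (fun ξ : EuclideanSpace ℝ (Fin 2) => (ξ 0 - z 0) * (ξ 1 - z 1) / ‖ξ - z‖ ^ 4) K :=
    ContinuousOn.div (by fun_prop) (by fun_prop) (fun ξ h => pow_ne_zero _ (hne ξ h))
  have i1 : IntegrableOn (fun ξ : EuclideanSpace ℝ (Fin 2) => (ξ 0 - z 0) * (ξ 1 - z 1) / ‖ξ - z‖ ^ 4 * (b ξ - b z)) A :=
    ((hkc.mul (by fun_prop)).integrableOn_compact hK).mono_set hAK
  have i2 : IntegrableOn (fun ξ : EuclideanSpace ℝ (Fin 2) => (ξ 0 - z 0) * (ξ 1 - z 1) / ‖ξ - z‖ ^ 4 * b z) A :=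
    ((hkc.mul (by fun_prop)).integrableOn_compact hK).mono_set hAK
  have i3 : IntegrableOn (fun ξ : EuclideanSpace ℝ (Fin 2) => M * ‖ξ - z‖⁻¹) A :=
    ((continuousOn_const.mul (ContinuousOn.inv₀ (by fun_prop) hne)).integrableOn_compact hK).mono_set
      hAK
  have hs : ∫ ξ in A, ((ξ 0 - z 0) * (ξ 1 - z 1) / ‖ξ - z‖ ^ 4) * b ξ
      = ∫ ξ in A, ((ξ 0 - z 0) * (ξ 1 - z 1) / ‖ξ - z‖ ^ 4) * (b ξ - b z) := by
    have h := integral_add i1 i2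
    rw [integral_mul_const, aux_zero z r R, zero_mul, add_zero] at h
    rw [← h]
    congr 1
    funext ξ
    ring
  rw [hs, ← Real.norm_eq_abs]
  have hle : ‖∫ ξ in A, ((ξ 0 - z 0) * (ξ 1 - z 1) / ‖ξ - z‖ ^ 4) * (b ξ - b z)‖
      ≤ ∫ ξ in A, M * ‖ξ - z‖⁻¹ := by
    refine norm_integral_le_of_norm_le i3 ?_
    refine (ae_restrict_mem hm).mono fun ξ hξ => ?_
    have hp : 0 < ‖ξ - z‖ := hr.trans hξ.1
    have hL : ‖b ξ - b z‖ ≤ M * ‖ξ - z‖ :=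
      convex_univ.norm_image_sub_le_of_norm_fderiv_le (fun x _ => hb x) (fun x _ => hM x)
        (mem_univ z) (mem_univ ξ)
    have h0 : ‖ξ 0 - z 0‖ ≤ ‖ξ - z‖ := PiLp.norm_apply_le (ξ - z) 0
    have h1 : ‖ξ 1 - z 1‖ ≤ ‖ξ - z‖ := PiLp.norm_apply_le (ξ - z) 1
    rw [norm_mul, norm_div, norm_mul, norm_pow, norm_norm]
    calc _ ≤ ‖ξ - z‖ * ‖ξ - z‖ / ‖ξ - z‖ ^ 4 * (M * ‖ξ - z‖) := by gcongr
      _ = M * ‖ξ - z‖⁻¹ := by field_simp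
  refine hle.trans ?_
  rw [integral_const_mul, aux_inv z r R hr hR]
  have : 0 ≤ M * volume.real (Metric.ball (0 : EuclideanSpace ℝ (Fin 2)) 1) * r := by positivity
  nlinarith
end
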